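/- Under the gap condition, take φ := u₁ in the conformal deformation g_t = e^{tφ}g_Γ. Then, as t → 0, λ₁(t)·V_φ(t)^{2/n} = λ₁·D^{2/n} + ((n−1)²·λ₁·D^{(2−n)/n}/12)·t² + o(t²); in particular the coefficient of t² is strictly positive. -/

import Mathlib

open MeasureTheory Real Filter Topology Asymptotics
open scoped InnerProductSpace

noncomputable section

/-- Euclidean space `ℝⁿ`. -/
abbrev E (n : ℕ) := EuclideanSpace ℝ (Fin n)

/-- The vector `A·t ∈ ℝⁿ`. -/
def matVec {n : ℕ} (A : Matrix (Fin n) (Fin n) ℝ) (t : Fin n → ℝ) : E n :=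
  (WithLp.equiv 2 (Fin n → ℝ)).symm (A.mulVec t)

/-- The lattice `Γ = A·ℤⁿ`. -/
def lattice {n : ℕ} (A : Matrix (Fin n) (Fin n) ℝ) : Set (E n) :=
  {x | ∃ m : Fin n → ℤ, x = matVec A fun i => (m i : ℝ)}

/-- The dual lattice `Γ* = {w : ⟨w,x⟩ ∈ ℤ for all x ∈ Γ}`. -/
def dualLattice {n : ℕ} (Γ : Set (E n)) : Set (E n) :=
  {w | ∀ x ∈ Γ, ∃ k : ℤ, ⟪w, x⟫_ℝ = (k : ℝ)}

/-- `f` is `Γ`-periodic. -/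
def IsPeriodic {n : ℕ} (Γ : Set (E n)) (f : E n → ℝ) : Prop :=
  ∀ x : E n, ∀ γ ∈ Γ, f (x + γ) = f x

/-- The fundamental domain `F = A·[0,1)ⁿ`. -/
def fundDomain {n : ℕ} (A : Matrix (Fin n) (Fin n) ℝ) : Set (E n) :=
  {x | ∃ t : Fin n → ℝ, (∀ i, t i ∈ Set.Ico (0:ℝ) 1) ∧ x = matVec A t}

/-- Geometer's (nonnegative) Laplacian: `Δ f = -∑ᵢ ∂²f/∂xᵢ²`. -/
def lap {n : ℕ} (f : E n → ℝ) (x : E n) : ℝ :=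
  -∑ i : Fin n, iteratedFDeriv ℝ 2 f x ![EuclideanSpace.single i 1, EuclideanSpace.single i 1]

/-- The gap condition: `w ∈ Γ* \ {0}` and `|w| < |v|` for every `v ∈ Γ* \ {0, w, -w}`. -/
def GapCondition {n : ℕ} (Γ : Set (E n)) (w : E n) : Prop :=
  w ∈ dualLattice Γ ∧ w ≠ 0 ∧
    ∀ v ∈ dualLattice Γ, v ≠ 0 → v ≠ w → v ≠ -w → ‖w‖ < ‖v‖

/-- `u₁(x) = √2·D^{-1/2}·sin(2π⟨w,x⟩)` where `D = |det A|`. -/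
def uSin {n : ℕ} (A : Matrix (Fin n) (Fin n) ℝ) (w : E n) : E n → ℝ :=
  fun x => Real.sqrt 2 / Real.sqrt |A.det| * Real.sin (2 * π * ⟪w, x⟫_ℝ)

/-- `u₂(x) = √2·D^{-1/2}·cos(2π⟨w,x⟩)` where `D = |det A|`. -/
def uCos {n : ℕ} (A : Matrix (Fin n) (Fin n) ℝ) (w : E n) : E n → ℝ :=
  fun x => Real.sqrt 2 / Real.sqrt |A.det| * Real.cos (2 * π * ⟪w, x⟫_ℝ)

/-- The volume `V_φ(t) = ∫_F e^{ntφ/2} dx` of the conformal metric `e^{tφ}g_Γ`. -/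
def confVol {n : ℕ} (A : Matrix (Fin n) (Fin n) ℝ) (φ : E n → ℝ) (t : ℝ) : ℝ :=
  ∫ x in fundDomain A, Real.exp ((n : ℝ) * t * φ x / 2)

/-- The first positive Laplace eigenvalue `λ₁(t)` of the conformal metric `e^{tφ}g_Γ`,
as the infimum of the Rayleigh quotient over smooth `Γ`-periodic functions that are
not identically zero and have zero mean with respect to the conformal volume measure. -/
def confLam1 {n : ℕ} (A : Matrix (Fin n) (Fin n) ℝ) (φ : E n → ℝ) (t : ℝ) : ℝ :=
  sInf {r : ℝ | ∃ f : E n → ℝ, ContDiff ℝ (⊤ : ℕ∞) f ∧ IsPeriodic (lattice A) f ∧ f ≠ 0 ∧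
    (∫ x in fundDomain A, f x * Real.exp ((n : ℝ) * t * φ x / 2)) = 0 ∧
    r = (∫ x in fundDomain A, ‖gradient f x‖ ^ 2 * Real.exp (((n : ℝ) - 2) * t * φ x / 2)) /
        (∫ x in fundDomain A, (f x) ^ 2 * Real.exp ((n : ℝ) * t * φ x / 2))}

section Lattice

variable {n : ℕ} {A : Matrix (Fin n) (Fin n) ℝ}

lemma matVec_add (s t : Fin n → ℝ) : matVec A (s + t) = matVec A s + matVec A t := by
  simp [matVec, Matrix.mulVec_add]

lemma continuous_matVec : Continuous (matVec A) :=
  (PiLp.continuous_toLp 2 _).comp (Continuous.matrix_mulVec continuous_const continuous_id)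

lemma matVec_surjective (hA : IsUnit A.det) : Function.Surjective (matVec A) := by
  intro x
  refine ⟨A⁻¹.mulVec x.ofLp, ?_⟩
  simp [matVec, Matrix.mulVec_mulVec, Matrix.mul_nonsing_inv _ hA]

lemma fundDomain_eq_image :
    fundDomain A = matVec A '' {t | ∀ i, t i ∈ Set.Ico (0 : ℝ) 1} := by
  ext x
  simp only [fundDomain, Set.mem_ofPred_eq, Set.mem_image]
  exact ⟨fun ⟨t, h, e⟩ => ⟨t, h, e.symm⟩, fun ⟨t, h, e⟩ => ⟨t, h, e.symm⟩⟩

lemma fundDomain_subset_isCompact : ∃ K : Set (E n), IsCompact K ∧ fundDomain A ⊆ K := by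
  refine ⟨matVec A '' Set.Icc 0 1, isCompact_Icc.image continuous_matVec, ?_⟩
  rw [fundDomain_eq_image]
  exact Set.image_mono fun t ht => ⟨fun i => (ht i).1, fun i => (ht i).2.le⟩

lemma measurableSet_fundDomain (hA : IsUnit A.det) : MeasurableSet (fundDomain A) := by
  have h : fundDomain A = {x : E n | ∀ i, A⁻¹.mulVec x.ofLp i ∈ Set.Ico (0 : ℝ) 1} := by
    ext x
    constructor
    · rintro ⟨t, ht, rfl⟩
      simpa [matVec, Matrix.mulVec_mulVec, Matrix.nonsing_inv_mul _ hA] using ht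
    · intro hx
      exact ⟨_, hx, by simp [matVec, Matrix.mulVec_mulVec, Matrix.mul_nonsing_inv _ hA]⟩
  rw [h, Set.ofPred_forall]
  refine MeasurableSet.iInter fun i => ?_
  have : Continuous fun x : E n => A⁻¹.mulVec x.ofLp i :=
    (continuous_apply i).comp
      (Continuous.matrix_mulVec continuous_const (PiLp.continuous_ofLp 2 _))
  exact this.measurable measurableSet_Ico

lemma Continuous.integrableOn_fundDomain {V : Type*} [NormedAddCommGroup V] {g : E n → V}
    (hg : Continuous g) : IntegrableOn g (fundDomain A) := by
  obtain ⟨K, hK, hF⟩ := fundDomain_subset_isCompact (A := A)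
  exact (hg.continuousOn.integrableOn_compact hK).mono_set hF

lemma setIntegral_fundDomain {V : Type*} [NormedAddCommGroup V] [NormedSpace ℝ V]
    (hA : IsUnit A.det) (g : E n → V) :
    ∫ x in fundDomain A, g x
      = |A.det| • ∫ t in {t : Fin n → ℝ | ∀ i, t i ∈ Set.Ioc (0 : ℝ) (0 + 1)},
        g (matVec A t) := by
  have h1 := (PiLp.volume_preserving_toLp (Fin n)).setIntegral_preimage_emb
    (MeasurableEquiv.toLp 2 (Fin n → ℝ)).measurableEmbedding g (fundDomain A)
  rw [← h1]
  set S : Set (Fin n → ℝ) := {t | ∀ i, t i ∈ Set.Ico (0 : ℝ) 1} with hS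
  have h2 : (WithLp.toLp 2 ⁻¹' fundDomain A : Set (Fin n → ℝ))
      = LinearMap.toContinuousLinearMap (Matrix.toLin' A) '' S := by
    ext y
    simp only [Set.mem_preimage, fundDomain, matVec, Set.mem_ofPred_eq, Set.mem_image, hS]
    constructor
    · rintro ⟨t, ht, e⟩
      exact ⟨t, ht, by simpa using (congrArg WithLp.ofLp e).symm⟩
    · rintro ⟨t, ht, e⟩
      exact ⟨t, ht, by simp [← e]⟩
  have hSm : MeasurableSet S := by
    rw [hS, Set.ofPred_forall]
    exact MeasurableSet.iInter fun i => measurable_pi_apply i measurableSet_Ico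
  have hinj : Set.InjOn (LinearMap.toContinuousLinearMap (Matrix.toLin' A)) S := by
    apply Function.Injective.injOn
    intro s t hst
    have := congrArg (A⁻¹.mulVec) hst
    simpa [Matrix.mulVec_mulVec, Matrix.nonsing_inv_mul _ hA] using this
  rw [h2, integral_image_eq_integral_abs_det_fderiv_smul volume hSm
    (f' := fun _ => LinearMap.toContinuousLinearMap (Matrix.toLin' A))
    (fun x _ => (LinearMap.toContinuousLinearMap (Matrix.toLin' A)).hasFDerivAt.hasFDerivWithinAt)
    hinj, integral_smul]
  have h3 : (LinearMap.toContinuousLinearMap (Matrix.toLin' A)).det = A.det := by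
    simp [ContinuousLinearMap.det]
  rw [h3]
  congr 1
  have h4 : S =ᵐ[volume] {t : Fin n → ℝ | ∀ i, t i ∈ Set.Ioc (0 : ℝ) (0 + 1)} := by
    have a := Measure.univ_pi_Ico_ae_eq_Icc (μ := fun _ : Fin n => (volume : Measure ℝ))
      (f := fun _ => 0) (g := fun _ => 1)
    have b := Measure.univ_pi_Ioc_ae_eq_Icc (μ := fun _ : Fin n => (volume : Measure ℝ))
      (f := fun _ => 0) (g := fun _ => 1)
    have e1 : S = Set.univ.pi fun _ => Set.Ico (0 : ℝ) 1 := by ext; simp [hS]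
    have e2 : {t : Fin n → ℝ | ∀ i, t i ∈ Set.Ioc (0 : ℝ) (0 + 1)}
      = Set.univ.pi fun _ => Set.Ioc (0 : ℝ) 1 := by ext; simp
    rw [e1, e2]
    exact a.trans b.symm
  rw [setIntegral_congr_set h4]
  rfl

end Lattice

section Torus

local instance : MeasureSpace UnitAddCircle := ⟨AddCircle.haarAddCircle⟩

local instance : Measure.IsAddHaarMeasure (volume : Measure UnitAddCircle) :=
  inferInstanceAs (Measure.IsAddHaarMeasure AddCircle.haarAddCircle)

local instance : IsProbabilityMeasure (volume : Measure UnitAddCircle) :=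
  inferInstanceAs (IsProbabilityMeasure AddCircle.haarAddCircle)

variable {n : ℕ} {A : Matrix (Fin n) (Fin n) ℝ}

/-- The point of `ℝⁿ` with coordinates in `(0, 1]` representing a point of the unit torus. -/
def torusRep (τ : UnitAddTorus (Fin n)) : Fin n → ℝ :=
  fun i => (AddCircle.equivIoc 1 0 (τ i) : ℝ)

/-- The function on the unit torus induced by a `Γ`-periodic function on `ℝⁿ`. -/
def torusLift {V : Type*} (A : Matrix (Fin n) (Fin n) ℝ) (g : E n → V)
    (τ : UnitAddTorus (Fin n)) : V :=
  g (matVec A (torusRep τ))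

/-- Periodicity with values in an arbitrary type. -/
def LatPeriodic {V : Type*} (A : Matrix (Fin n) (Fin n) ℝ) (g : E n → V) : Prop :=
  ∀ x, ∀ γ ∈ lattice A, g (x + γ) = g x

lemma measurable_torusRep : Measurable (torusRep : UnitAddTorus (Fin n) → Fin n → ℝ) := by
  refine measurable_pi_lambda _ fun i => ?_
  exact measurable_subtype_coe.comp
    ((AddCircle.measurableEquivIoc (1 : ℝ) 0).measurable.comp (measurable_pi_apply i))

lemma coe_torusRep (τ : UnitAddTorus (Fin n)) :
    (fun i => ((torusRep τ i : ℝ) : UnitAddCircle)) = τ := by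
  funext i
  exact (AddCircle.equivIoc (1 : ℝ) 0).symm_apply_apply (τ i)

lemma torusLift_coe {V : Type*} {g : E n → V} (hg : LatPeriodic A g) (t : Fin n → ℝ) :
    torusLift A g (fun i => ((t i : ℝ) : UnitAddCircle)) = g (matVec A t) := by
  set r := torusRep (fun i => ((t i : ℝ) : UnitAddCircle)) with hr
  have h := coe_torusRep (fun i => ((t i : ℝ) : UnitAddCircle))
  have h1 : ∀ i, ∃ k : ℤ, r i - t i = k := by
    intro i
    have := congrFun h i
    rw [← hr, ← sub_eq_zero, ← AddCircle.coe_sub, AddCircle.coe_eq_zero_iff] at this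
    obtain ⟨k, hk⟩ := this
    exact ⟨k, by simpa using hk.symm⟩
  choose m hm using h1
  have h2 : r = t + fun i => (m i : ℝ) := by
    funext i
    simp [← hm i]
  rw [torusLift, ← hr, h2, matVec_add]
  exact hg _ _ ⟨m, rfl⟩

lemma setIntegral_fundDomain_eq_torus {V : Type*} [NormedAddCommGroup V] [NormedSpace ℝ V]
    (hA : IsUnit A.det) {g : E n → V} (hg : LatPeriodic A g) :
    ∫ x in fundDomain A, g x = |A.det| • ∫ τ : UnitAddTorus (Fin n), torusLift A g τ := by
  rw [setIntegral_fundDomain hA, UnitAddTorus.integral_preimage (torusLift A g) 0]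
  simp_rw [torusLift_coe hg]
  rfl

lemma setIntegral_fundDomain_const (hA : IsUnit A.det) (c : ℝ) :
    ∫ _ in fundDomain A, c = c * |A.det| := by
  rw [setIntegral_fundDomain_eq_torus hA (g := fun _ : E n => c) (fun _ _ _ => rfl)]
  simp [torusLift, mul_comm]

lemma setIntegral_fundDomain_translate {V : Type*} [NormedAddCommGroup V] [NormedSpace ℝ V]
    (hA : IsUnit A.det) {g : E n → V} (hg : LatPeriodic A g) (v : E n) :
    ∫ x in fundDomain A, g (x + v) = ∫ x in fundDomain A, g x := by
  obtain ⟨u, rfl⟩ := matVec_surjective hA v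
  have hg' : LatPeriodic A fun x => g (x + matVec A u) := by
    intro x γ hγ
    change g (x + γ + _) = _
    rw [add_right_comm]
    exact hg _ _ hγ
  rw [setIntegral_fundDomain_eq_torus hA hg', setIntegral_fundDomain_eq_torus hA hg]
  congr 1
  rw [← integral_add_right_eq_self (torusLift A g) (fun i => ((u i : ℝ) : UnitAddCircle))]
  congr 1
  funext τ
  rw [← coe_torusRep τ, torusLift_coe hg']
  have : ((fun i => ((torusRep τ i : ℝ) : UnitAddCircle)) + fun i => ((u i : ℝ) : UnitAddCircle))
      = fun i => (((torusRep τ + u) i : ℝ) : UnitAddCircle) := by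
    funext i; simp
  rw [this, torusLift_coe hg, matVec_add]

/-- The dual lattice vector `A⁻ᵀ m`. -/
def dualVec (A : Matrix (Fin n) (Fin n) ℝ) (m : Fin n → ℤ) : E n :=
  WithLp.toLp 2 (A⁻¹.transpose.mulVec fun i => (m i : ℝ))

lemma inner_dualVec_matVec (hA : IsUnit A.det) (m : Fin n → ℤ) (t : Fin n → ℝ) :
    ⟪dualVec A m, matVec A t⟫_ℝ = ∑ i, m i * t i := by
  have : ⟪dualVec A m, matVec A t⟫_ℝ
      = (A⁻¹.transpose.mulVec fun i => (m i : ℝ)) ⬝ᵥ A.mulVec t := by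
    simp [dualVec, matVec, EuclideanSpace.inner_eq_star_dotProduct, dotProduct_comm]
  rw [this, Matrix.mulVec_transpose, ← Matrix.dotProduct_mulVec, Matrix.mulVec_mulVec,
    Matrix.nonsing_inv_mul _ hA, Matrix.one_mulVec]
  rfl

lemma dualVec_mem (hA : IsUnit A.det) (m : Fin n → ℤ) : dualVec A m ∈ dualLattice (lattice A) := by
  rintro _ ⟨k, rfl⟩
  exact ⟨∑ i, m i * k i, by rw [inner_dualVec_matVec hA]; push_cast; rfl⟩

/-- The complex exponential `e^{-2πi⟨v,x⟩}`. -/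
def planeWave (v : E n) (x : E n) : ℂ := Complex.exp (-(2 * π * ⟪v, x⟫_ℝ : ℝ) * Complex.I)

lemma continuous_planeWave (v : E n) : Continuous (planeWave v) := by
  unfold planeWave
  fun_prop

lemma planeWave_periodic {v : E n} (hv : v ∈ dualLattice (lattice A)) :
    LatPeriodic A (planeWave v) := by
  intro x γ hγ
  obtain ⟨k, hk⟩ := hv γ hγ
  rw [planeWave, planeWave, inner_add_right, hk, Complex.exp_eq_exp_iff_exists_int]
  exact ⟨-k, by push_cast; ring⟩

lemma mFourierCoeff_torusLift (hA : IsUnit A.det) {g : E n → ℂ} (hg : LatPeriodic A g)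
    (m : Fin n → ℤ) :
    ((|A.det| : ℝ) : ℂ) * UnitAddTorus.mFourierCoeff (torusLift A g) m
      = ∫ x in fundDomain A, planeWave (dualVec A m) x * g x := by
  have hp : LatPeriodic A fun x => planeWave (dualVec A m) x * g x := fun x γ hγ => by
    change _ * _ = _
    rw [planeWave_periodic (dualVec_mem hA m) x γ hγ, hg x γ hγ]
  rw [setIntegral_fundDomain_eq_torus hA hp, UnitAddTorus.mFourierCoeff, Complex.real_smul]
  congr 2
  funext τ
  rw [← coe_torusRep τ, torusLift_coe hg, torusLift_coe hp, smul_eq_mul]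
  congr 1
  simp only [UnitAddTorus.mFourier, ContinuousMap.coe_mk, Pi.neg_apply, fourier_coe_apply,
    planeWave, inner_dualVec_matVec hA, ← Complex.exp_sum]
  congr 1
  push_cast
  rw [Finset.mul_sum, ← Finset.sum_neg_distrib, Finset.sum_mul]
  refine Finset.sum_congr rfl fun i _ => ?_
  ring

lemma memLp_torusLift {g : E n → ℂ} (hg : Continuous g) :
    MemLp (torusLift A g) 2 (volume : Measure (UnitAddTorus (Fin n))) := by
  have hb : ∃ C, ∀ t ∈ Set.Icc (0 : Fin n → ℝ) 1, ‖g (matVec A t)‖ ≤ C :=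
    isCompact_Icc.exists_bound_of_continuousOn (hg.comp continuous_matVec).continuousOn
  obtain ⟨C, hC⟩ := hb
  refine MemLp.of_bound (C := C) ?_ (Eventually.of_forall fun τ => hC _ ?_)
  · exact ((hg.comp continuous_matVec).measurable.comp measurable_torusRep).aestronglyMeasurable
  · have := fun i => (AddCircle.equivIoc (1 : ℝ) 0 (τ i)).2
    exact ⟨fun i => (this i).1.le, fun i => by simpa [torusRep] using (this i).2⟩

lemma hasSum_sq_planeWave (hA : IsUnit A.det) {g : E n → ℂ} (hc : Continuous g)
    (hg : LatPeriodic A g) :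
    HasSum (fun m : Fin n → ℤ => ‖∫ x in fundDomain A, planeWave (dualVec A m) x * g x‖ ^ 2)
      (|A.det| * ∫ x in fundDomain A, ‖g x‖ ^ 2) := by
  have hm := memLp_torusLift (A := A) hc
  have h := UnitAddTorus.hasSum_sq_mFourierCoeff (hm.toLp (torusLift A g))
  have hcoe : ∀ m, UnitAddTorus.mFourierCoeff (hm.toLp (torusLift A g)) m
      = UnitAddTorus.mFourierCoeff (torusLift A g) m := fun m =>
    integral_congr_ae (by filter_upwards [hm.coeFn_toLp] with τ h; rw [h])
  have hint : ∫ τ, ‖hm.toLp (torusLift A g) τ‖ ^ 2 = ∫ τ : UnitAddTorus (Fin n), ‖torusLift A g τ‖ ^ 2 :=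
    integral_congr_ae (by filter_upwards [hm.coeFn_toLp] with τ h; rw [h])
  rw [hint] at h
  have hp : LatPeriodic A fun x => ‖g x‖ ^ 2 := fun x γ hγ => by
    change ‖_‖ ^ 2 = _
    rw [hg x γ hγ]
  rw [setIntegral_fundDomain_eq_torus hA hp, smul_eq_mul, ← mul_assoc]
  have heq : (fun m : Fin n → ℤ => ‖∫ x in fundDomain A, planeWave (dualVec A m) x * g x‖ ^ 2)
      = fun m => |A.det| * |A.det|
        * ‖UnitAddTorus.mFourierCoeff (hm.toLp (torusLift A g)) m‖ ^ 2 := by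
    funext m
    rw [← mFourierCoeff_torusLift hA hg, hcoe, norm_mul, mul_pow, ← pow_two]
    simp
  rw [heq]
  exact h.mul_left _

end Torus

section Analysis

variable {n : ℕ} {A : Matrix (Fin n) (Fin n) ℝ}

lemma setIntegral_fderiv_eq_zero {V : Type*} [NormedAddCommGroup V] [NormedSpace ℝ V]
    (hA : IsUnit A.det) {g : E n → V} (hc : ContDiff ℝ 1 g) (hg : LatPeriodic A g) (v : E n) :
    ∫ x in fundDomain A, fderiv ℝ g x v = 0 := by
  obtain ⟨K, hK, hF⟩ := fundDomain_subset_isCompact (A := A)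
  have hcf : Continuous fun p : E n × ℝ => fderiv ℝ g (p.1 + p.2 • v) v :=
    ((hc.continuous_fderiv one_ne_zero).comp (by fun_prop)).clm_apply continuous_const
  obtain ⟨C, hC⟩ := (hK.prod (isCompact_Icc (a := (-1 : ℝ)) (b := 1))).exists_bound_of_continuousOn
    hcf.continuousOn
  have hd : ∀ (x : E n) (r : ℝ),
      HasDerivAt (fun r : ℝ => g (x + r • v)) (fderiv ℝ g (x + r • v) v) r := by
    intro x r
    have h1 : HasDerivAt (fun r : ℝ => x + r • v) v r := by
      simpa using ((hasDerivAt_id r).smul_const v).const_add x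
    exact ((hc.differentiable one_ne_zero) _).hasFDerivAt.comp_hasDerivAt r h1
  have key := (hasDerivAt_integral_of_dominated_loc_of_deriv_le (μ := volume.restrict (fundDomain A))
    (F := fun (r : ℝ) x => g (x + r • v)) (F' := fun r x => fderiv ℝ g (x + r • v) v)
    (bound := fun _ => C) (x₀ := (0 : ℝ)) (s := Set.Icc (-1) 1)
    (Icc_mem_nhds (by norm_num) (by norm_num))
    (Eventually.of_forall fun r =>
      (hc.continuous.comp (by fun_prop : Continuous fun x : E n => x + r • v)).aestronglyMeasurable)
    ((hc.continuous.comp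
      (by fun_prop : Continuous fun x : E n => x + (0 : ℝ) • v)).integrableOn_fundDomain)
    ((hcf.comp (by fun_prop : Continuous fun x : E n => (x, (0 : ℝ)))).aestronglyMeasurable)
    ((ae_restrict_iff' (measurableSet_fundDomain hA)).2
      (Eventually.of_forall fun x hx r hr => hC (x, r) ⟨hF hx, hr⟩))
    (continuous_const.integrableOn_fundDomain)
    (Eventually.of_forall fun x r _ => hd x r)).2
  have hconst : (fun r : ℝ => ∫ x in fundDomain A, g (x + r • v))
      = fun _ => ∫ x in fundDomain A, g x :=
    funext fun r => setIntegral_fundDomain_translate hA hg _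
  rw [hconst] at key
  simpa using key.unique (hasDerivAt_const _ _)

lemma norm_gradient_sq (h : E n → ℝ) (x : E n) :
    ‖gradient h x‖ ^ 2 = ∑ i, (fderiv ℝ h x (EuclideanSpace.single i 1)) ^ 2 := by
  rw [EuclideanSpace.norm_sq_eq]
  refine Finset.sum_congr rfl fun i _ => ?_
  have : fderiv ℝ h x (EuclideanSpace.single i 1) = gradient h x i := by
    rw [← toDual_gradient, InnerProductSpace.toDual_apply_apply, EuclideanSpace.inner_single_right]
    simp
  rw [this, Real.norm_eq_abs, sq_abs]

lemma inner_gradient (h : E n → ℝ) (x v : E n) : ⟪v, gradient h x⟫_ℝ = fderiv ℝ h x v := by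
  rw [← toDual_gradient, InnerProductSpace.toDual_apply_apply, real_inner_comm]

lemma LatPeriodic.fderiv {V : Type*} [NormedAddCommGroup V] [NormedSpace ℝ V] {g : E n → V}
    (hg : LatPeriodic A g) : LatPeriodic A (fderiv ℝ g) := by
  intro x γ hγ
  rw [← fderiv_comp_add_right]
  congr 1
  funext y
  exact hg y γ hγ

lemma hasFDerivAt_planeWave (v x : E n) :
    HasFDerivAt (planeWave v)
      ((planeWave v x * (-(2 * π : ℝ) * Complex.I)) •
        (Complex.ofRealCLM.comp (innerSL ℝ v))) x := by
  have h1 : HasFDerivAt (fun x : E n => ((⟪v, x⟫_ℝ : ℝ) : ℂ))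
      (Complex.ofRealCLM.comp (innerSL ℝ v)) x :=
    Complex.ofRealCLM.hasFDerivAt.comp x (innerSL ℝ v).hasFDerivAt
  have h2 := (h1.const_mul (-(2 * π : ℝ) * Complex.I)).cexp
  have e : planeWave v = fun x : E n =>
      Complex.exp (-(2 * π : ℝ) * Complex.I * ((⟪v, x⟫_ℝ : ℝ) : ℂ)) := by
    funext y
    simp only [planeWave]
    congr 1
    push_cast
    ring
  rw [e]
  convert! h2 using 1
  rw [smul_smul]

lemma setIntegral_planeWave_fderiv (hA : IsUnit A.det) {h : E n → ℝ} (hc : ContDiff ℝ 1 h)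
    (hp : LatPeriodic A h) {v : E n} (hv : v ∈ dualLattice (lattice A)) (e : E n) :
    ∫ x in fundDomain A, planeWave v x * (fderiv ℝ h x e : ℂ)
      = (2 * π * ⟪v, e⟫_ℝ : ℝ) * Complex.I * ∫ x in fundDomain A, planeWave v x * (h x : ℂ) := by
  have hw : ContDiff ℝ 1 (planeWave v) := by
    have : ContDiff ℝ 1 fun x : E n => ((-(2 * π * ⟪v, x⟫_ℝ) : ℝ) : ℂ) :=
      Complex.ofRealCLM.contDiff.comp
        ((contDiff_const.mul (contDiff_const.inner ℝ contDiff_id)).neg)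
    have h2 : ContDiff ℝ 1 fun x : E n =>
        Complex.exp (((-(2 * π * ⟪v, x⟫_ℝ) : ℝ) : ℂ) * Complex.I) :=
      (this.mul contDiff_const).cexp
    convert! h2 using 1
    funext x
    simp [planeWave]
  have hh : ContDiff ℝ 1 fun x => (h x : ℂ) := Complex.ofRealCLM.contDiff.comp hc
  have hG : ContDiff ℝ 1 fun x => planeWave v x * (h x : ℂ) := hw.mul hh
  have hGp : LatPeriodic A fun x => planeWave v x * (h x : ℂ) := fun x γ hγ => by
    change _ * _ = _
    rw [planeWave_periodic hv x γ hγ, hp x γ hγ]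
  have h0 := setIntegral_fderiv_eq_zero hA hG hGp e
  have hfd : ∀ x, fderiv ℝ (fun x => planeWave v x * (h x : ℂ)) x e
      = planeWave v x * (fderiv ℝ h x e : ℂ)
        - (2 * π * ⟪v, e⟫_ℝ : ℝ) * Complex.I * (planeWave v x * (h x : ℂ)) := by
    intro x
    have d1 : HasFDerivAt (fun x => (h x : ℂ)) (Complex.ofRealCLM.comp (fderiv ℝ h x)) x :=
      Complex.ofRealCLM.hasFDerivAt.comp x ((hc.differentiable one_ne_zero) x).hasFDerivAt
    have d2 : HasFDerivAt (fun x => planeWave v x * (h x : ℂ)) _ x :=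
      (hasFDerivAt_planeWave v x).mul d1
    rw [d2.fderiv]
    simp
    ring
  simp_rw [hfd] at h0
  have hcf : Continuous fun x => (fderiv ℝ h x e : ℂ) :=
    Complex.continuous_ofReal.comp
      ((hc.continuous_fderiv one_ne_zero).clm_apply continuous_const)
  have i1 : IntegrableOn (fun x => planeWave v x * (fderiv ℝ h x e : ℂ)) (fundDomain A) :=
    Continuous.integrableOn_fundDomain ((continuous_planeWave v).mul hcf)
  have i2 : IntegrableOn (fun x => ((2 * π * ⟪v, e⟫_ℝ : ℝ) : ℂ) * Complex.I
      * (planeWave v x * (h x : ℂ))) (fundDomain A) :=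
    Continuous.integrableOn_fundDomain (continuous_const.mul hG.continuous)
  rw [integral_sub i1 i2, integral_const_mul, sub_eq_zero] at h0
  exact h0

/-- The dual lattice has no vectors other than `0, ±w` in a slightly larger ball. -/
lemma exists_spectral_gap (hA : IsUnit A.det) {w : E n} (hgap : GapCondition (lattice A) w) :
    ∃ R > ‖w‖, ∀ m, dualVec A m = 0 ∨ dualVec A m = w ∨ dualVec A m = -w ∨ R ≤ ‖dualVec A m‖ := by
  have hfin : {m : Fin n → ℤ | ‖dualVec A m‖ ≤ ‖w‖ + 1}.Finite := by
    set N : Fin n → ℤ := fun i => ⌈(‖w‖ + 1) * ‖matVec A (Pi.single i 1)‖⌉ with hN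
    refine (Set.finite_Icc (-N) N).subset fun m hm => ?_
    have : ∀ i, |(m i : ℝ)| ≤ N i := by
      intro i
      have h1 := inner_dualVec_matVec hA m (Pi.single i 1)
      simp only [Pi.single_apply, mul_ite, mul_one, mul_zero, Finset.sum_ite_eq',
        Finset.mem_univ, if_true] at h1
      rw [← h1]
      exact (abs_real_inner_le_norm _ _).trans
        ((mul_le_mul_of_nonneg_right hm (norm_nonneg _)).trans (Int.le_ceil _))
    refine ⟨fun i => ?_, fun i => ?_⟩
    · have := (abs_le.1 (this i)).1
      simp only [Pi.neg_apply]
      exact_mod_cast this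
    · exact_mod_cast (abs_le.1 (this i)).2
  have hev : ∀ᶠ R in 𝓝[>] ‖w‖, ∀ m ∈ {m : Fin n → ℤ | ‖dualVec A m‖ ≤ ‖w‖ + 1},
      dualVec A m = 0 ∨ dualVec A m = w ∨ dualVec A m = -w ∨ R ≤ ‖dualVec A m‖ := by
    rw [eventually_all_finite hfin]
    intro m _
    by_cases h0 : dualVec A m = 0
    · exact Eventually.of_forall fun _ => Or.inl h0
    by_cases h1 : dualVec A m = w
    · exact Eventually.of_forall fun _ => Or.inr (Or.inl h1)
    by_cases h2 : dualVec A m = -w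
    · exact Eventually.of_forall fun _ => Or.inr (Or.inr (Or.inl h2))
    have h3 := hgap.2.2 _ (dualVec_mem hA m) h0 h1 h2
    filter_upwards [Ioc_mem_nhdsGT h3] with R hR
    exact Or.inr (Or.inr (Or.inr hR.2))
  have hev2 : ∀ᶠ R in 𝓝[>] ‖w‖, R ∈ Set.Ioc ‖w‖ (‖w‖ + 1) :=
    Ioc_mem_nhdsGT (lt_add_one _)
  obtain ⟨R, hR, hR1, hR2⟩ := (hev.and hev2).exists
  refine ⟨R, hR1, fun m => ?_⟩
  by_cases hm : ‖dualVec A m‖ ≤ ‖w‖ + 1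
  · exact hR m hm
  · exact Or.inr (Or.inr (Or.inr (hR2.trans (not_le.1 hm).le)))

lemma setIntegral_planeWave_eq {h : E n → ℝ} (hc : Continuous h) (v : E n) :
    ∫ x in fundDomain A, planeWave v x * (h x : ℂ)
      = ((∫ x in fundDomain A, h x * Real.cos (2 * π * ⟪v, x⟫_ℝ) : ℝ) : ℂ)
        - ((∫ x in fundDomain A, h x * Real.sin (2 * π * ⟪v, x⟫_ℝ) : ℝ) : ℂ) * Complex.I := by
  have hp : ∀ x, planeWave v x * (h x : ℂ)
      = ((h x * Real.cos (2 * π * ⟪v, x⟫_ℝ) : ℝ) : ℂ)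
        - ((h x * Real.sin (2 * π * ⟪v, x⟫_ℝ) : ℝ) : ℂ) * Complex.I := by
    intro x
    rw [planeWave, ← Complex.ofReal_neg, Complex.exp_mul_I, ← Complex.ofReal_cos,
      ← Complex.ofReal_sin, Real.cos_neg, Real.sin_neg]
    push_cast
    ring
  simp_rw [hp]
  have i1 : Continuous fun x : E n => ((h x * Real.cos (2 * π * ⟪v, x⟫_ℝ) : ℝ) : ℂ) := by
    fun_prop
  have i2 : Continuous fun x : E n =>
      ((h x * Real.sin (2 * π * ⟪v, x⟫_ℝ) : ℝ) : ℂ) * Complex.I := by fun_prop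
  rw [integral_sub i1.integrableOn_fundDomain i2.integrableOn_fundDomain, integral_mul_const,
    integral_complex_ofReal, integral_complex_ofReal]

/-- Improved Poincaré inequality on the orthogonal complement of `1, cos, sin`. -/
lemma poincare_of_gap (hA : IsUnit A.det) {w : E n} {R : ℝ} (hR0 : 0 ≤ R)
    (hR : ∀ m, dualVec A m = 0 ∨ dualVec A m = w ∨ dualVec A m = -w ∨ R ≤ ‖dualVec A m‖)
    {h : E n → ℝ} (hc : ContDiff ℝ 1 h) (hp : LatPeriodic A h)
    (h1 : ∫ x in fundDomain A, h x = 0)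
    (h2 : ∫ x in fundDomain A, h x * Real.cos (2 * π * ⟪w, x⟫_ℝ) = 0)
    (h3 : ∫ x in fundDomain A, h x * Real.sin (2 * π * ⟪w, x⟫_ℝ) = 0) :
    4 * π ^ 2 * R ^ 2 * ∫ x in fundDomain A, h x ^ 2
      ≤ ∫ x in fundDomain A, ‖gradient h x‖ ^ 2 := by
  have hD : 0 < |A.det| := abs_pos.2 hA.ne_zero
  set c : (Fin n → ℤ) → ℂ := fun m => ∫ x in fundDomain A, planeWave (dualVec A m) x * (h x : ℂ)
    with hcdef
  have s0 := hasSum_sq_planeWave (g := fun x => (h x : ℂ)) hA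
    (Complex.continuous_ofReal.comp hc.continuous)
    (fun x γ hγ => by change ((h (x + γ) : ℝ) : ℂ) = _; rw [hp x γ hγ])
  have hfc : ∀ e : E n, Continuous fun x => fderiv ℝ h x e := fun e =>
    (hc.continuous_fderiv one_ne_zero).clm_apply continuous_const
  have si : ∀ i : Fin n, HasSum (fun m => (2 * π * dualVec A m i) ^ 2 * ‖c m‖ ^ 2)
      (|A.det| * ∫ x in fundDomain A, (fderiv ℝ h x (EuclideanSpace.single i 1)) ^ 2) := by
    intro i
    have := hasSum_sq_planeWave
      (g := fun x => ((fderiv ℝ h x (EuclideanSpace.single i 1) : ℝ) : ℂ)) hA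
      (Complex.continuous_ofReal.comp (hfc _))
      (fun x γ hγ => by
        change ((fderiv ℝ h (x + γ) _ : ℝ) : ℂ) = _; rw [hp.fderiv x γ hγ])
    simp only [setIntegral_planeWave_fderiv hA hc hp (dualVec_mem hA _), Complex.norm_real,
      Real.norm_eq_abs, sq_abs, norm_mul, mul_pow, Complex.norm_I, one_pow, mul_one,
      EuclideanSpace.inner_single_right] at this
    simpa [mul_pow] using this
  have sg : HasSum (fun m => 4 * π ^ 2 * ‖dualVec A m‖ ^ 2 * ‖c m‖ ^ 2)
      (|A.det| * ∫ x in fundDomain A, ‖gradient h x‖ ^ 2) := by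
    have hs := hasSum_sum (s := Finset.univ) fun i _ => si i
    have e1 : (fun m => 4 * π ^ 2 * ‖dualVec A m‖ ^ 2 * ‖c m‖ ^ 2)
        = fun m => ∑ i, (2 * π * dualVec A m i) ^ 2 * ‖c m‖ ^ 2 := by
      funext m
      rw [EuclideanSpace.norm_sq_eq, Finset.mul_sum, Finset.sum_mul]
      refine Finset.sum_congr rfl fun i _ => ?_
      rw [Real.norm_eq_abs, sq_abs]
      ring
    rw [e1]
    convert! hs using 1
    simp_rw [norm_gradient_sq]
    have hi : ∀ i ∈ Finset.univ, Integrable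
        (fun x => fderiv ℝ h x (EuclideanSpace.single i 1) ^ 2)
        (volume.restrict (fundDomain A)) := fun i _ =>
      Continuous.integrableOn_fundDomain ((hfc _).pow 2)
    rw [integral_finsetSum _ hi, Finset.mul_sum]
  have hle := hasSum_le (fun m => ?_) (s0.mul_left (4 * π ^ 2 * R ^ 2)) sg
  · simp only [Complex.norm_real, Real.norm_eq_abs, sq_abs] at hle
    have : |A.det| * (4 * π ^ 2 * R ^ 2 * ∫ x in fundDomain A, h x ^ 2)
        ≤ |A.det| * ∫ x in fundDomain A, ‖gradient h x‖ ^ 2 := by linarith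
    exact le_of_mul_le_mul_left this hD
  · change 4 * π ^ 2 * R ^ 2 * ‖c m‖ ^ 2 ≤ 4 * π ^ 2 * ‖dualVec A m‖ ^ 2 * ‖c m‖ ^ 2
    have hz : ∀ v, (v = 0 ∨ v = w ∨ v = -w) →
        ∫ x in fundDomain A, planeWave v x * (h x : ℂ) = 0 := by
      rintro v (rfl | rfl | rfl) <;> rw [setIntegral_planeWave_eq hc.continuous]
      · simp [h1]
      · simp [h2, h3]
      · simp [h2, h3, integral_neg]
    by_cases hm : R ≤ ‖dualVec A m‖
    · gcongr
    · have : c m = 0 := hz _ (by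
        rcases hR m with h | h | h | h
        · exact Or.inl h
        · exact Or.inr (Or.inl h)
        · exact Or.inr (Or.inr h)
        · exact absurd h hm)
      simp [this]

lemma setIntegral_pos_of_continuous (hA : IsUnit A.det) {g : E n → ℝ} (hc : Continuous g)
    (hp : LatPeriodic A g) (h0 : ∀ x, 0 ≤ g x) (hne : g ≠ 0) :
    0 < ∫ x in fundDomain A, g x := by
  have hD : 0 < |A.det| := abs_pos.2 hA.ne_zero
  refine lt_of_le_of_ne (integral_nonneg h0) fun hzero => hne ?_
  rw [setIntegral_fundDomain hA, smul_eq_mul, eq_comm, mul_eq_zero, or_iff_right hD.ne'] at hzero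
  set S : Set (Fin n → ℝ) := {t | ∀ i, t i ∈ Set.Ioc (0 : ℝ) (0 + 1)} with hS
  have hS' : S = Set.univ.pi fun _ => Set.Ioc (0 : ℝ) 1 := by ext; simp [hS]
  have hcc : Continuous fun t => g (matVec A t) := hc.comp continuous_matVec
  have hint : IntegrableOn (fun t => g (matVec A t)) S :=
    (hcc.continuousOn.integrableOn_compact (isCompact_Icc (a := (0 : Fin n → ℝ)) (b := 1))).mono_set
      fun t ht => ⟨fun i => (ht i).1.le, fun i => by simpa using (ht i).2⟩
  rw [integral_eq_zero_iff_of_nonneg (fun t => h0 _) hint] at hzero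
  have heq := Measure.eqOn_of_ae_eq hzero hcc.continuousOn continuousOn_const (by
    rw [hS', interior_pi_set Set.finite_univ, closure_pi_set]
    refine Set.pi_mono fun i _ => ?_
    rw [interior_Ioc, closure_Ioo zero_ne_one]
    exact Set.Ioc_subset_Icc_self)
  funext x
  obtain ⟨t, rfl⟩ := matVec_surjective hA x
  rw [← torusLift_coe hp]
  exact heq fun i => by
    simpa [torusRep] using (AddCircle.equivIoc (1 : ℝ) 0 (t i)).2

end Analysis

section Profile

/-- First-order corrector coefficient. -/
def corrOne (α β : ℝ) : ℝ := (β / 2 - α) / 3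

/-- Second-order corrector coefficient. -/
def corrTwo (α β : ℝ) : ℝ :=
  (12 * α * corrOne α β + 3 * α ^ 2 / 2 - 2 * β * corrOne α β - β ^ 2 / 2) / 32

/-- Second-order eigenvalue coefficient of the cosine branch. -/
def muCos (α β : ℝ) : ℝ := 8 * corrTwo α β - 2 * α * corrOne α β

/-- Second-order eigenvalue coefficient of the sine branch. -/
def muSin (α β : ℝ) : ℝ := α ^ 2 / 8 + β ^ 2 / 8 - 3 * corrOne α β ^ 2

/-- Second-order approximate eigenfunction with leading term `p cos + q sin`, as a polynomial in
`S = sin` and `C = cos`. -/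
def profPoly (α β s p q S C : ℝ) : ℝ :=
  p * (C + 2 * s * corrOne α β * S * C + s ^ 2 * corrTwo α β * (4 * C ^ 3 - 3 * C))
  + q * (S - s * β / 2 - s * corrOne α β * (1 - 2 * S ^ 2)
    + s ^ 2 * corrTwo α β * (3 * S - 4 * S ^ 3))

/-- Derivative of `profPoly`. -/
def profPoly' (α β s p q S C : ℝ) : ℝ :=
  p * (-S + 2 * s * corrOne α β * (C ^ 2 - S ^ 2)
    + s ^ 2 * corrTwo α β * (3 * S - 12 * C ^ 2 * S))
  + q * (C + 4 * s * corrOne α β * S * C + s ^ 2 * corrTwo α β * (3 * C - 12 * S ^ 2 * C))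

/-- Second derivative of `profPoly`. -/
def profPoly'' (α β s p q S C : ℝ) : ℝ :=
  p * (-C - 8 * s * corrOne α β * S * C
    + s ^ 2 * corrTwo α β * (24 * C * S ^ 2 - 12 * C ^ 3 + 3 * C))
  + q * (-S + 4 * s * corrOne α β * (C ^ 2 - S ^ 2)
    + s ^ 2 * corrTwo α β * (-3 * S - 24 * S * C ^ 2 + 12 * S ^ 3))

/-- Residual `-(aV')'- μ b V` in the one-dimensional eigenvalue equation, with
`a = e^{αs sin}`, `b = e^{βs sin}`, `μ = 1 + κ s²`. -/
def profRes (α β κ s p q S C : ℝ) : ℝ :=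
  -(Real.exp (α * s * S) * (α * s * C * profPoly' α β s p q S C + profPoly'' α β s p q S C))
  - (1 + κ * s ^ 2) * Real.exp (β * s * S) * profPoly α β s p q S C

/-- The cubic remainder of the residual. -/
def resRem (α β κ p q s S C ra rb : ℝ) : ℝ :=
  let k := corrOne α β
  let l := corrTwo α β
  let v1 := p * (2 * k * S * C) + q * (-β / 2 - k * (1 - 2 * S ^ 2))
  let v2 := l * (p * (4 * C ^ 3 - 3 * C) + q * (3 * S - 4 * S ^ 3))
  let x1 := α * C * (-p * S + q * C) + (-8 * p * k * S * C + 4 * q * k * (C ^ 2 - S ^ 2))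
  let x2 := α * C * (2 * p * k * (C ^ 2 - S ^ 2) + 4 * q * k * S * C)
    + l * (p * (24 * C * S ^ 2 - 12 * C ^ 3 + 3 * C) + q * (-3 * S - 24 * S * C ^ 2 + 12 * S ^ 3))
  let x3 := α * C * (l * (p * (3 * S - 12 * C ^ 2 * S) + q * (3 * C - 12 * S ^ 2 * C)))
  let m1 := β * S
  let m2 := β ^ 2 * S ^ 2 / 2 + κ
  let m3 := rb + κ * β * S + s * κ * β ^ 2 * S ^ 2 / 2 + s ^ 2 * κ * rb
  (-1 : ℝ) * (ra * (α * s * C * profPoly' α β s p q S C + profPoly'' α β s p q S C)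
    + α * S * x2 + α ^ 2 * S ^ 2 / 2 * x1 + x3
    + s * (α * S * x3 + α ^ 2 * S ^ 2 / 2 * x2) + s ^ 2 * (α ^ 2 * S ^ 2 / 2) * x3)
  - (m3 * profPoly α β s p q S C + m1 * v2 + m2 * v1 + s * m2 * v2)

lemma profRes_expansion (α β κ p q s S C ra rb : ℝ) (h : S ^ 2 + C ^ 2 = 1)
    (ha : Real.exp (α * s * S) = 1 + α * s * S + (α * s * S) ^ 2 / 2 + s ^ 3 * ra)
    (hb : Real.exp (β * s * S) = 1 + β * s * S + (β * s * S) ^ 2 / 2 + s ^ 3 * rb) :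
    profRes α β κ s p q S C
      = s ^ 2 * ((muCos α β - κ) * p * C + (muSin α β - κ) * q * S)
        + s ^ 3 * resRem α β κ p q s S C ra rb := by
  rw [profRes, ha, hb]
  simp only [resRem, profPoly, profPoly', profPoly'', muCos, muSin, corrTwo, corrOne]
  linear_combination (norm := skip) (-(s * q * (α + 4 * corrOne α β) + s ^ 2 * (p * C * (2 * α * corrOne α β
    - 8 * corrTwo α β) + q * S * (8 * α * corrOne α β - 24 * corrTwo α β + α ^ 2)))) * h
  simp only [corrTwo, corrOne]
  ring

lemma exists_exp_remainder (γ s S : ℝ) (hs : |γ * s| ≤ 1) (hS : |S| ≤ 1) :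
    ∃ r, |r| ≤ |γ| ^ 3 ∧
      Real.exp (γ * s * S) = 1 + γ * s * S + (γ * s * S) ^ 2 / 2 + s ^ 3 * r := by
  rcases eq_or_ne s 0 with rfl | hs0
  · exact ⟨0, by simp, by simp⟩
  refine ⟨(Real.exp (γ * s * S) - (1 + γ * s * S + (γ * s * S) ^ 2 / 2)) / s ^ 3, ?_, ?_⟩
  · have hx : |γ * s * S| ≤ 1 := by
      rw [abs_mul]
      exact mul_le_one₀ hs (abs_nonneg _) hS
    have hb := Real.exp_bound hx (n := 3) (by norm_num)
    simp only [Finset.sum_range_succ, Finset.sum_range_zero] at hb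
    have hb' : |Real.exp (γ * s * S) - (1 + γ * s * S + (γ * s * S) ^ 2 / 2)|
        ≤ |γ * s * S| ^ 3 * (2 / 9) := by
      convert hb using 2
      · congr 1
        norm_num [Nat.factorial]
      · norm_num [Nat.factorial]
    rw [abs_div, div_le_iff₀ (by positivity), abs_pow]
    refine hb'.trans ?_
    have h1 : |γ * s * S| ≤ |γ| * |s| := by
      rw [abs_mul, abs_mul]
      exact mul_le_of_le_one_right (by positivity) hS
    have h2 : |γ * s * S| ^ 3 ≤ (|γ| * |s|) ^ 3 := by gcongr
    rw [mul_pow] at h2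
    have h3 : 0 ≤ |γ * s * S| ^ 3 := by positivity
    linarith
  · field_simp
    ring

lemma exists_resRem_bound (α β κ : ℝ) : ∃ K, ∀ p q s S C ra rb : ℝ, |s| ≤ 1 → |S| ≤ 1 → |C| ≤ 1 →
    |ra| ≤ |α| ^ 3 → |rb| ≤ |β| ^ 3 → |resRem α β κ p q s S C ra rb| ≤ K * (|p| + |q|) := by
  have hc : ∀ p q : ℝ, ∃ K, ∀ z : ℝ × ℝ × ℝ × ℝ × ℝ,
      z ∈ Set.Icc ((-1, -1, -1, -|α| ^ 3, -|β| ^ 3) : ℝ × ℝ × ℝ × ℝ × ℝ)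
        (1, 1, 1, |α| ^ 3, |β| ^ 3) →
      ‖resRem α β κ p q z.1 z.2.1 z.2.2.1 z.2.2.2.1 z.2.2.2.2‖ ≤ K := fun p q =>
    isCompact_Icc.exists_bound_of_continuousOn (Continuous.continuousOn (by
      simp only [resRem, profPoly, profPoly', profPoly'']
      fun_prop))
  obtain ⟨K₁, h₁⟩ := hc 1 0
  obtain ⟨K₂, h₂⟩ := hc 0 1
  refine ⟨max K₁ K₂, fun p q s S C ra rb hs hS hC ha hb => ?_⟩
  have hz : ((s, S, C, ra, rb) : ℝ × ℝ × ℝ × ℝ × ℝ) ∈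
      Set.Icc ((-1, -1, -1, -|α| ^ 3, -|β| ^ 3) : ℝ × ℝ × ℝ × ℝ × ℝ)
        (1, 1, 1, |α| ^ 3, |β| ^ 3) := by
    rw [abs_le] at hs hS hC ha hb
    exact ⟨⟨hs.1, hS.1, hC.1, ha.1, hb.1⟩, ⟨hs.2, hS.2, hC.2, ha.2, hb.2⟩⟩
  have e : resRem α β κ p q s S C ra rb
      = p * resRem α β κ 1 0 s S C ra rb + q * resRem α β κ 0 1 s S C ra rb := by
    simp only [resRem, profPoly, profPoly', profPoly'']
    ring
  have b₁ := (h₁ _ hz).trans (le_max_left K₁ K₂)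
  have b₂ := (h₂ _ hz).trans (le_max_right K₁ K₂)
  rw [Real.norm_eq_abs] at b₁ b₂
  rw [e]
  calc _ ≤ |p| * _ + |q| * _ := (abs_add_le _ _).trans (by rw [abs_mul, abs_mul])
    _ ≤ |p| * max K₁ K₂ + |q| * max K₁ K₂ := by gcongr
    _ = _ := by ring

lemma exists_profPoly_bound (α β : ℝ) : ∃ K, ∀ p q s S C : ℝ, |s| ≤ 1 → |S| ≤ 1 → |C| ≤ 1 →
    |profPoly α β s p q S C| ≤ K * (|p| + |q|) ∧
    ∃ z, |z| ≤ K * (|p| + |q|) ∧ profPoly α β s p q S C = p * C + q * S + s * z := by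
  have hc : ∀ f : ℝ × ℝ × ℝ → ℝ, Continuous f → ∃ K, ∀ z : ℝ × ℝ × ℝ,
      z ∈ Set.Icc ((-1, -1, -1) : ℝ × ℝ × ℝ) (1, 1, 1) → ‖f z‖ ≤ K := fun f hf =>
    isCompact_Icc.exists_bound_of_continuousOn hf.continuousOn
  obtain ⟨K₁, h₁⟩ := hc (fun z => 2 * corrOne α β * z.2.1 * z.2.2
    + z.1 * corrTwo α β * (4 * z.2.2 ^ 3 - 3 * z.2.2)) (by fun_prop)
  obtain ⟨K₂, h₂⟩ := hc (fun z => - β / 2 - corrOne α β * (1 - 2 * z.2.1 ^ 2)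
    + z.1 * corrTwo α β * (3 * z.2.1 - 4 * z.2.1 ^ 3)) (by fun_prop)
  refine ⟨1 + max K₁ K₂, fun p q s S C hs hS hC => ?_⟩
  have hz : ((s, S, C) : ℝ × ℝ × ℝ) ∈ Set.Icc ((-1, -1, -1) : ℝ × ℝ × ℝ) (1, 1, 1) := by
    rw [abs_le] at hs hS hC
    exact ⟨⟨hs.1, hS.1, hC.1⟩, ⟨hs.2, hS.2, hC.2⟩⟩
  have b₁ := (h₁ _ hz).trans (le_max_left K₁ K₂)
  have b₂ := (h₂ _ hz).trans (le_max_right K₁ K₂)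
  rw [Real.norm_eq_abs] at b₁ b₂
  set z₁ := 2 * corrOne α β * S * C + s * corrTwo α β * (4 * C ^ 3 - 3 * C) with hz₁
  set z₂ := - β / 2 - corrOne α β * (1 - 2 * S ^ 2) + s * corrTwo α β * (3 * S - 4 * S ^ 3) with hz₂
  have e : profPoly α β s p q S C = p * C + q * S + s * (p * z₁ + q * z₂) := by
    simp only [profPoly, hz₁, hz₂]
    ring
  have hM : 0 ≤ max K₁ K₂ := (abs_nonneg _).trans b₁
  have bz : |p * z₁ + q * z₂| ≤ max K₁ K₂ * (|p| + |q|) := by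
    calc _ ≤ |p| * |z₁| + |q| * |z₂| := (abs_add_le _ _).trans (by rw [abs_mul, abs_mul])
      _ ≤ |p| * max K₁ K₂ + |q| * max K₁ K₂ := by gcongr
      _ = _ := by ring
  have bv : |p * C + q * S| ≤ |p| + |q| := by
    calc _ ≤ |p| * |C| + |q| * |S| := (abs_add_le _ _).trans (by rw [abs_mul, abs_mul])
      _ ≤ |p| * 1 + |q| * 1 := by gcongr
      _ = _ := by ring
  refine ⟨?_, _, bz.trans (by nlinarith [abs_nonneg p, abs_nonneg q]), e⟩
  rw [e]
  have : |s * (p * z₁ + q * z₂)| ≤ max K₁ K₂ * (|p| + |q|) := by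
    rw [abs_mul]
    exact (mul_le_of_le_one_left (abs_nonneg _) hs).trans bz
  linarith [abs_add_le (p * C + q * S) (s * (p * z₁ + q * z₂))]

lemma quad_growth_bound {K : ℝ} (hK : 0 ≤ K) (p q h : ℝ) :
    K * (|p| + |q|) * (K * (|p| + |q|)) + K * (|p| + |q|) * (K * (|p| + |q|) + 2 * |h|)
      ≤ 6 * (K * (K + K + 2)) * (p ^ 2 + q ^ 2 + h ^ 2) := by
  have hP2 : (|p| + |q|) ^ 2 ≤ 2 * (p ^ 2 + q ^ 2) := by
    nlinarith [sq_nonneg (|p| - |q|), sq_abs p, sq_abs q]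
  have hPh : 2 * ((|p| + |q|) * |h|) ≤ (|p| + |q|) ^ 2 + h ^ 2 := by
    nlinarith [sq_nonneg (|p| + |q| - |h|), sq_abs h]
  generalize |p| + |q| = P at *
  generalize p ^ 2 + q ^ 2 = Q at *
  have t1 : K * K * P ^ 2 ≤ K * K * (2 * Q) := by gcongr
  have t2 : K * (2 * (P * |h|)) ≤ K * (2 * Q + h ^ 2) := by
    gcongr
    linarith
  have hQ : 0 ≤ Q := by nlinarith [sq_nonneg P]
  have t3 : 0 ≤ K * K * h ^ 2 := by positivity
  have t4 : 0 ≤ K * K * Q := by positivity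
  have t5 : 0 ≤ K * Q := by positivity
  have t6 : 0 ≤ K * h ^ 2 := by positivity
  linear_combination 2 * t1 + t2 + 12 * t3 + 8 * t4 + 10 * t5 + 11 * t6

lemma exists_profile_estimate (α β κ : ℝ) : ∃ K > 0, ∃ s₀ > 0, ∀ s S C p q h : ℝ, |s| ≤ s₀ →
    S ^ 2 + C ^ 2 = 1 →
    |profPoly α β s p q S C| ≤ K * (|p| + |q|) ∧
    |profRes α β κ s p q S C * (profPoly α β s p q S C + 2 * h)
      - s ^ 2 * (((muCos α β - κ) * p * C + (muSin α β - κ) * q * S) * (p * C + q * S + 2 * h))|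
      ≤ K * |s| ^ 3 * (p ^ 2 + q ^ 2 + h ^ 2) := by
  obtain ⟨K₁, h₁⟩ := exists_resRem_bound α β κ
  obtain ⟨K₂, h₂⟩ := exists_profPoly_bound α β
  set K₃ := max (max K₁ K₂) (max (|muCos α β - κ|) (|muSin α β - κ|)) with hK₃
  have hK₃0 : 0 ≤ K₃ := (abs_nonneg _).trans ((le_max_left _ _).trans (le_max_right _ _))
  refine ⟨1 + K₃ + 6 * (K₃ * (K₃ + K₃ + 2)), by positivity, 1 / (1 + |α| + |β|), by positivity,
    fun s S C p q h hs hSC => ?_⟩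
  have hs' : |s| * (1 + |α| + |β|) ≤ 1 := by
    rwa [le_div_iff₀ (by positivity)] at hs
  have hs1 : |s| ≤ 1 := by nlinarith [abs_nonneg s, abs_nonneg α, abs_nonneg β]
  have ha : |α * s| ≤ 1 := by
    rw [abs_mul]; nlinarith [abs_nonneg s, abs_nonneg α, abs_nonneg β]
  have hb : |β * s| ≤ 1 := by
    rw [abs_mul]; nlinarith [abs_nonneg s, abs_nonneg α, abs_nonneg β]
  have hS : |S| ≤ 1 := by rw [← sq_le_one_iff_abs_le_one]; nlinarith [sq_nonneg C]
  have hC : |C| ≤ 1 := by rw [← sq_le_one_iff_abs_le_one]; nlinarith [sq_nonneg S]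
  obtain ⟨ra, hra, ea⟩ := exists_exp_remainder α s S ha hS
  obtain ⟨rb, hrb, eb⟩ := exists_exp_remainder β s S hb hS
  obtain ⟨bV, z, bz, eV⟩ := h₂ p q s S C hs1 hS hC
  have bρ := h₁ p q s S C ra rb hs1 hS hC hra hrb
  set ρ := resRem α β κ p q s S C ra rb
  set V := profPoly α β s p q S C
  set e₀ := (muCos α β - κ) * p * C + (muSin α β - κ) * q * S with he₀
  have hK₄ : K₃ ≤ 1 + K₃ + 6 * (K₃ * (K₃ + K₃ + 2)) := by
    have : 0 ≤ 6 * (K₃ * (K₃ + K₃ + 2)) := by positivity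
    linarith
  set P := |p| + |q| with hP
  have hP0 : 0 ≤ P := by positivity
  have k1 : K₁ ≤ K₃ := (le_max_left _ _).trans (le_max_left _ _)
  have k2 : K₂ ≤ K₃ := (le_max_right _ _).trans (le_max_left _ _)
  have bV' : |V| ≤ K₃ * P := bV.trans (by gcongr)
  have bz' : |z| ≤ K₃ * P := bz.trans (by gcongr)
  have bρ' : |ρ| ≤ K₃ * P := bρ.trans (by gcongr)
  have be : |e₀| ≤ K₃ * P := by
    calc |e₀| ≤ |muCos α β - κ| * |p| * |C| + |muSin α β - κ| * |q| * |S| :=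
          (abs_add_le _ _).trans (by simp only [abs_mul]; rfl)
      _ ≤ K₃ * |p| * 1 + K₃ * |q| * 1 := by
          gcongr
          · exact (le_max_left _ _).trans (le_max_right _ _)
          · exact (le_max_right _ _).trans (le_max_right _ _)
      _ = K₃ * P := by rw [hP]; ring
  refine ⟨bV'.trans (mul_le_mul_of_nonneg_right hK₄ hP0), ?_⟩
  rw [profRes_expansion α β κ p q s S C ra rb hSC ea eb]
  have e : (s ^ 2 * e₀ + s ^ 3 * ρ) * (V + 2 * h) - s ^ 2 * (e₀ * (p * C + q * S + 2 * h))
      = s ^ 3 * (e₀ * z + ρ * (V + 2 * h)) := by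
    rw [eV]; ring
  rw [e, abs_mul, abs_pow]
  have b1 : |e₀ * z + ρ * (V + 2 * h)| ≤ K₃ * P * (K₃ * P) + K₃ * P * (K₃ * P + 2 * |h|) := by
    refine (abs_add_le _ _).trans ?_
    rw [abs_mul, abs_mul]
    have : |V + 2 * h| ≤ K₃ * P + 2 * |h| := by
      refine (abs_add_le _ _).trans ?_
      rw [abs_mul, abs_two]
      gcongr
    gcongr
  have b2 := quad_growth_bound hK₃0 p q h
  have h4 : 0 ≤ p ^ 2 + q ^ 2 + h ^ 2 := by positivity
  calc |s| ^ 3 * |e₀ * z + ρ * (V + 2 * h)|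
      ≤ |s| ^ 3 * (6 * (K₃ * (K₃ + K₃ + 2)) * (p ^ 2 + q ^ 2 + h ^ 2)) := by
        gcongr; exact b1.trans b2
    _ ≤ |s| ^ 3 * ((1 + K₃ + 6 * (K₃ * (K₃ + K₃ + 2))) * (p ^ 2 + q ^ 2 + h ^ 2)) := by
        gcongr; linarith
    _ = _ := by ring

end Profile

section Phase

variable {n : ℕ} {A : Matrix (Fin n) (Fin n) ℝ} {w : E n}

/-- The phase `2π⟨w,x⟩`. -/
def phase (w x : E n) : ℝ := 2 * π * ⟪w, x⟫_ℝ

lemma hasFDerivAt_phase (w x : E n) :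
    HasFDerivAt (phase w) ((2 * π) • innerSL ℝ w) x :=
  ((innerSL ℝ w).hasFDerivAt (x := x)).const_mul (2 * π)

lemma contDiff_phase {k : WithTop ℕ∞} (w : E n) : ContDiff ℝ k (phase w) := by
  unfold phase
  exact contDiff_const.mul (contDiff_const.inner ℝ contDiff_id)

@[fun_prop]
lemma continuous_phase (w : E n) : Continuous (phase w) := (contDiff_phase (k := 0) w).continuous

lemma latPeriodic_comp_phase {V : Type*} (hw : w ∈ dualLattice (lattice A)) {P : ℝ → V}
    (hP : Function.Periodic P (2 * π)) : LatPeriodic A fun x => P (phase w x) := by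
  intro x γ hγ
  obtain ⟨k, hk⟩ := hw γ hγ
  have : phase w (x + γ) = phase w x + k * (2 * π) := by
    rw [phase, phase, inner_add_right, hk]
    ring
  change P _ = _
  rw [this]
  exact hP.int_mul k _

lemma contDiff_one_of_hasDerivAt {P P' : ℝ → ℝ} (h : ∀ y, HasDerivAt P (P' y) y)
    (hc : Continuous P') : ContDiff ℝ 1 P := by
  rw [contDiff_one_iff_deriv]
  refine ⟨fun y => (h y).differentiableAt, ?_⟩
  have : deriv P = P' := funext fun y => (h y).deriv
  rwa [this]

lemma hasFDerivAt_comp_phase {P P' : ℝ → ℝ} (h : ∀ y, HasDerivAt P (P' y) y) (x : E n) :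
    HasFDerivAt (fun x => P (phase w x)) ((P' (phase w x)) • (2 * π) • innerSL ℝ w) x :=
  (h _).comp_hasFDerivAt x (hasFDerivAt_phase w x)

lemma setIntegral_phase_mul_fderiv (hA : IsUnit A.det) (hw : w ∈ dualLattice (lattice A))
    {P P' : ℝ → ℝ} (h : ∀ y, HasDerivAt P (P' y) y) (hc : Continuous P')
    (hP : Function.Periodic P (2 * π)) {g : E n → ℝ} (hg : ContDiff ℝ 1 g)
    (hgp : LatPeriodic A g) :
    ∫ x in fundDomain A, P (phase w x) * fderiv ℝ g x w
      = -(2 * π * ‖w‖ ^ 2) * ∫ x in fundDomain A, P' (phase w x) * g x := by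
  have hP1 : ContDiff ℝ 1 P := contDiff_one_of_hasDerivAt h hc
  have hPc : ContDiff ℝ 1 fun x => P (phase w x) := hP1.comp (contDiff_phase w)
  have hper : LatPeriodic A fun x => P (phase w x) * g x := fun x γ hγ => by
    change P (phase w (x + γ)) * g (x + γ) = _
    have := latPeriodic_comp_phase hw hP x γ hγ
    simp only at this
    rw [this, hgp x γ hγ]
  have h0 := setIntegral_fderiv_eq_zero hA (hPc.mul hg) hper w
  have hd : ∀ x, fderiv ℝ (fun x => P (phase w x) * g x) x w
      = P (phase w x) * fderiv ℝ g x w + 2 * π * ‖w‖ ^ 2 * (P' (phase w x) * g x) := by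
    intro x
    have : HasFDerivAt (fun x => P (phase w x) * g x) _ x :=
      (hasFDerivAt_comp_phase (w := w) h x).mul (hg.differentiable one_ne_zero x).hasFDerivAt
    rw [this.fderiv]
    simp only [add_apply, FunLike.coe_smul, Pi.smul_apply, smul_eq_mul, innerSL_apply_apply,
      real_inner_self_eq_norm_sq]
    ring
  simp_rw [hd] at h0
  have hgc := hg.continuous
  have hgf := (hg.continuous_fderiv one_ne_zero).clm_apply (continuous_const (y := w))
  have hPcc := hPc.continuous
  have i1 : IntegrableOn (fun x => P (phase w x) * fderiv ℝ g x w) (fundDomain A) :=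
    Continuous.integrableOn_fundDomain (hPcc.mul hgf)
  have i2 : IntegrableOn (fun x => 2 * π * ‖w‖ ^ 2 * (P' (phase w x) * g x)) (fundDomain A) :=
    Continuous.integrableOn_fundDomain (by fun_prop)
  rw [integral_add i1 i2, integral_const_mul] at h0
  linarith

lemma setIntegral_comp_phase (hA : IsUnit A.det) (hw : w ∈ dualLattice (lattice A)) (hw0 : w ≠ 0)
    {P Q : ℝ → ℝ} {c : ℝ} (h : ∀ y, HasDerivAt P (Q y - c) y) (hc : Continuous Q)
    (hP : Function.Periodic P (2 * π)) :
    ∫ x in fundDomain A, Q (phase w x) = c * |A.det| := by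
  have h1 := setIntegral_phase_mul_fderiv hA hw h (hc.sub continuous_const) hP
    (contDiff_const (c := (1 : ℝ))) (fun _ _ _ => rfl)
  have hne : (2 * π * ‖w‖ ^ 2) ≠ 0 := by
    have := norm_pos_iff.2 hw0
    positivity
  have i1 : IntegrableOn (fun x => Q (phase w x)) (fundDomain A) :=
    Continuous.integrableOn_fundDomain (by fun_prop)
  have i2 : IntegrableOn (fun _ : E n => c) (fundDomain A) :=
    Continuous.integrableOn_fundDomain continuous_const
  simp only [fderiv_fun_const, Pi.zero_apply, zero_apply, mul_zero, integral_zero, mul_one] at h1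
  rw [integral_sub i1 i2, setIntegral_fundDomain_const hA] at h1
  rcases mul_eq_zero.1 h1.symm with h2 | h2
  · exact absurd (neg_eq_zero.1 h2) hne
  · linarith

lemma periodic_trig {f : ℝ → ℝ → ℝ} : Function.Periodic (fun y => f (sin y) (cos y)) (2 * π) :=
  fun y => by simp only [sin_add_two_pi, cos_add_two_pi]

lemma setIntegral_sin_phase (hA : IsUnit A.det) (hw : w ∈ dualLattice (lattice A)) (hw0 : w ≠ 0) :
    ∫ x in fundDomain A, sin (phase w x) = 0 := by
  have h := setIntegral_comp_phase hA hw hw0 (P := fun y => -cos y) (Q := sin) (c := 0)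
    (fun y => (hasDerivAt_cos y).neg.congr_deriv (by simp)) continuous_sin
    (periodic_trig (f := fun _ C => -C))
  simpa using h

lemma setIntegral_cos_phase (hA : IsUnit A.det) (hw : w ∈ dualLattice (lattice A)) (hw0 : w ≠ 0) :
    ∫ x in fundDomain A, cos (phase w x) = 0 := by
  have h := setIntegral_comp_phase hA hw hw0 (P := sin) (Q := cos) (c := 0)
    (fun y => by simpa using (hasDerivAt_sin y)) continuous_cos
    (periodic_trig (f := fun S _ => S))
  simpa using h

lemma setIntegral_sin_sq_phase (hA : IsUnit A.det) (hw : w ∈ dualLattice (lattice A))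
    (hw0 : w ≠ 0) : ∫ x in fundDomain A, sin (phase w x) ^ 2 = |A.det| / 2 := by
  have h := setIntegral_comp_phase hA hw hw0 (P := fun y => -(sin y * cos y) / 2)
    (Q := fun y => sin y ^ 2) (c := 1 / 2)
    (fun y => (((hasDerivAt_sin y).mul (hasDerivAt_cos y)).neg.div_const 2).congr_deriv (by
      linear_combination (-1 / 2 : ℝ) * sin_sq_add_cos_sq y)) (by fun_prop)
    (periodic_trig (f := fun S C => -(S * C) / 2))
  rw [h]
  ring

lemma setIntegral_cos_sq_phase (hA : IsUnit A.det) (hw : w ∈ dualLattice (lattice A))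
    (hw0 : w ≠ 0) : ∫ x in fundDomain A, cos (phase w x) ^ 2 = |A.det| / 2 := by
  have h := setIntegral_comp_phase hA hw hw0 (P := fun y => (sin y * cos y) / 2)
    (Q := fun y => cos y ^ 2) (c := 1 / 2)
    (fun y => (((hasDerivAt_sin y).mul (hasDerivAt_cos y)).div_const 2).congr_deriv (by
      linear_combination (-1 / 2 : ℝ) * sin_sq_add_cos_sq y)) (by fun_prop)
    (periodic_trig (f := fun S C => (S * C) / 2))
  rw [h]
  ring

lemma setIntegral_sin_mul_cos_phase (hA : IsUnit A.det) (hw : w ∈ dualLattice (lattice A))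
    (hw0 : w ≠ 0) : ∫ x in fundDomain A, sin (phase w x) * cos (phase w x) = 0 := by
  have h := setIntegral_comp_phase hA hw hw0 (P := fun y => sin y ^ 2 / 2)
    (Q := fun y => sin y * cos y) (c := 0)
    (fun y => (((hasDerivAt_sin y).pow 2).div_const 2).congr_deriv (by
      simp
      ring)) (by fun_prop)
    (periodic_trig (f := fun S _ => S ^ 2 / 2))
  simpa using h

/-- The approximate eigenfunction as a function of the phase. -/
def prof (α β s p q y : ℝ) : ℝ := profPoly α β s p q (sin y) (cos y)

lemma contDiff_prof {k : WithTop ℕ∞} (α β s p q : ℝ) : ContDiff ℝ k (prof α β s p q) := by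
  unfold prof profPoly
  fun_prop

@[fun_prop]
lemma continuous_prof (α β s p q : ℝ) : Continuous (prof α β s p q) :=
  (contDiff_prof (k := 0) α β s p q).continuous

lemma prof_periodic (α β s p q : ℝ) : Function.Periodic (prof α β s p q) (2 * π) :=
  periodic_trig (f := profPoly α β s p q)

/-- Derivative of `prof`. -/
def prof' (α β s p q y : ℝ) : ℝ := profPoly' α β s p q (sin y) (cos y)

/-- Second derivative of `prof`. -/
def prof'' (α β s p q y : ℝ) : ℝ := profPoly'' α β s p q (sin y) (cos y)

@[fun_prop]
lemma continuous_prof' (α β s p q : ℝ) : Continuous (prof' α β s p q) := by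
  unfold prof' profPoly'
  fun_prop

@[fun_prop]
lemma continuous_prof'' (α β s p q : ℝ) : Continuous (prof'' α β s p q) := by
  unfold prof'' profPoly''
  fun_prop

lemma hasDerivAt_prof (α β s p q y : ℝ) :
    HasDerivAt (prof α β s p q) (prof' α β s p q y) y := by
  have hS := hasDerivAt_sin y
  have hC := hasDerivAt_cos y
  have h := (((hC.add ((hS.const_mul (2 * s * corrOne α β)).mul hC)).add
    ((((hC.pow 3).const_mul 4).sub (hC.const_mul 3)).const_mul (s ^ 2 * corrTwo α β))).const_mul
      p).add ((((hS.sub_const (s * β / 2)).sub ((((hS.pow 2).const_mul 2).const_sub 1).const_mul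
        (s * corrOne α β))).add (((hS.const_mul 3).sub ((hS.pow 3).const_mul 4)).const_mul
          (s ^ 2 * corrTwo α β))).const_mul q)
  refine h.congr_deriv ?_
  simp only [prof', profPoly', Nat.cast_ofNat, Nat.add_one_sub_one]
  ring

lemma hasDerivAt_prof' (α β s p q y : ℝ) :
    HasDerivAt (prof' α β s p q) (prof'' α β s p q y) y := by
  have hS := hasDerivAt_sin y
  have hC := hasDerivAt_cos y
  have h := (((hS.neg.add (((hC.pow 2).sub (hS.pow 2)).const_mul (2 * s * corrOne α β))).add
    (((hS.const_mul 3).sub (((hC.pow 2).const_mul 12).mul hS)).const_mul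
      (s ^ 2 * corrTwo α β))).const_mul p).add
      (((hC.add ((hS.const_mul (4 * s * corrOne α β)).mul hC)).add
        (((hC.const_mul 3).sub (((hS.pow 2).const_mul 12).mul hC)).const_mul
          (s ^ 2 * corrTwo α β))).const_mul q)
  refine h.congr_deriv ?_
  simp only [prof'', profPoly'', Nat.cast_ofNat, Nat.add_one_sub_one, Pi.pow_apply]
  ring

lemma setIntegral_prof (hA : IsUnit A.det) (hw : w ∈ dualLattice (lattice A)) (hw0 : w ≠ 0)
    (α β s p q : ℝ) :
    ∫ x in fundDomain A, prof α β s p q (phase w x) = -(q * s * β / 2) * |A.det| := by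
  refine setIntegral_comp_phase hA hw hw0 (P := fun y =>
    p * (sin y + s * corrOne α β * sin y ^ 2 + s ^ 2 * corrTwo α β * (sin y - 4 / 3 * sin y ^ 3))
    + q * (-cos y - s * corrOne α β * (sin y * cos y)
      + s ^ 2 * corrTwo α β * (cos y - 4 / 3 * cos y ^ 3))) (fun y => ?_) (by fun_prop)
    (periodic_trig (f := fun S C => p * (S + s * corrOne α β * S ^ 2
      + s ^ 2 * corrTwo α β * (S - 4 / 3 * S ^ 3)) + q * (-C - s * corrOne α β * (S * C)
      + s ^ 2 * corrTwo α β * (C - 4 / 3 * C ^ 3))))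
  have hS := hasDerivAt_sin y
  have hC := hasDerivAt_cos y
  have h := (((hS.add ((hS.pow 2).const_mul (s * corrOne α β))).add
    ((hS.sub ((hS.pow 3).const_mul (4 / 3))).const_mul (s ^ 2 * corrTwo α β))).const_mul p).add
    (((hC.neg.sub ((hS.mul hC).const_mul (s * corrOne α β))).add
      ((hC.sub ((hC.pow 3).const_mul (4 / 3))).const_mul (s ^ 2 * corrTwo α β))).const_mul q)
  refine h.congr_deriv ?_
  simp only [prof, profPoly, Nat.cast_ofNat, Nat.add_one_sub_one]
  have h2 : cos y ^ 2 = 1 - sin y ^ 2 := by linarith [sin_sq_add_cos_sq y]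
  have h3 : cos y ^ 3 = cos y - cos y * sin y ^ 2 := by rw [pow_succ, h2]; ring
  ring_nf
  rw [h3, h2]
  ring

lemma setIntegral_prof_mul_cos (hA : IsUnit A.det) (hw : w ∈ dualLattice (lattice A)) (hw0 : w ≠ 0)
    (α β s p q : ℝ) :
    ∫ x in fundDomain A, prof α β s p q (phase w x) * cos (phase w x) = p / 2 * |A.det| := by
  refine setIntegral_comp_phase hA hw hw0 (Q := fun y => prof α β s p q y * cos y) (P := fun y =>
    p * (sin y * cos y / 2 - 2 * s * corrOne α β / 3 * cos y ^ 3
      + s ^ 2 * corrTwo α β * (sin y * cos y - sin y ^ 3 * cos y))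
    + q * (sin y ^ 2 / 2 - s * β / 2 * sin y - s * corrOne α β * (sin y - 2 / 3 * sin y ^ 3)
      + s ^ 2 * corrTwo α β * (3 / 2 * sin y ^ 2 - sin y ^ 4))) (fun y => ?_) (by fun_prop)
    (periodic_trig (f := fun S C => p * (S * C / 2 - 2 * s * corrOne α β / 3 * C ^ 3
      + s ^ 2 * corrTwo α β * (S * C - S ^ 3 * C))
    + q * (S ^ 2 / 2 - s * β / 2 * S - s * corrOne α β * (S - 2 / 3 * S ^ 3)
      + s ^ 2 * corrTwo α β * (3 / 2 * S ^ 2 - S ^ 4))))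
  have hS := hasDerivAt_sin y
  have hC := hasDerivAt_cos y
  have h := (((((hS.mul hC).div_const 2).sub ((hC.pow 3).const_mul (2 * s * corrOne α β / 3))).add
    (((hS.mul hC).sub ((hS.pow 3).mul hC)).const_mul (s ^ 2 * corrTwo α β))).const_mul p).add
    ((((((hS.pow 2).div_const 2).sub (hS.const_mul (s * β / 2))).sub
      ((hS.sub ((hS.pow 3).const_mul (2 / 3))).const_mul (s * corrOne α β))).add
      ((((hS.pow 2).const_mul (3 / 2)).sub (hS.pow 4)).const_mul (s ^ 2 * corrTwo α β))).const_mul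
        q)
  refine h.congr_deriv ?_
  simp only [prof, profPoly, Nat.cast_ofNat, Nat.add_one_sub_one, Pi.pow_apply]
  have h2 : cos y ^ 2 = 1 - sin y ^ 2 := by linarith [sin_sq_add_cos_sq y]
  have h4 : cos y ^ 4 = (1 - sin y ^ 2) ^ 2 := by rw [← h2]; ring
  ring_nf
  rw [h4, h2]
  ring

lemma setIntegral_prof_mul_sin (hA : IsUnit A.det) (hw : w ∈ dualLattice (lattice A)) (hw0 : w ≠ 0)
    (α β s p q : ℝ) :
    ∫ x in fundDomain A, prof α β s p q (phase w x) * sin (phase w x) = q / 2 * |A.det| := by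
  refine setIntegral_comp_phase hA hw hw0 (Q := fun y => prof α β s p q y * sin y) (P := fun y =>
    p * (sin y ^ 2 / 2 + 2 * s * corrOne α β / 3 * sin y ^ 3
      + s ^ 2 * corrTwo α β * (3 / 2 * cos y ^ 2 - cos y ^ 4))
    + q * (-(sin y * cos y / 2) + s * β / 2 * cos y + s * corrOne α β * (2 / 3 * cos y ^ 3 - cos y)
      + s ^ 2 * corrTwo α β * (sin y ^ 3 * cos y))) (fun y => ?_) (by fun_prop)
    (periodic_trig (f := fun S C => p * (S ^ 2 / 2 + 2 * s * corrOne α β / 3 * S ^ 3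
      + s ^ 2 * corrTwo α β * (3 / 2 * C ^ 2 - C ^ 4))
    + q * (-(S * C / 2) + s * β / 2 * C + s * corrOne α β * (2 / 3 * C ^ 3 - C)
      + s ^ 2 * corrTwo α β * (S ^ 3 * C))))
  have hS := hasDerivAt_sin y
  have hC := hasDerivAt_cos y
  have h := (((((hS.pow 2).div_const 2).add ((hS.pow 3).const_mul (2 * s * corrOne α β / 3))).add
    ((((hC.pow 2).const_mul (3 / 2)).sub (hC.pow 4)).const_mul (s ^ 2 * corrTwo α β))).const_mul
      p).add ((((((hS.mul hC).div_const 2).neg.add (hC.const_mul (s * β / 2))).add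
      ((((hC.pow 3).const_mul (2 / 3)).sub hC).const_mul (s * corrOne α β))).add
      (((hS.pow 3).mul hC).const_mul (s ^ 2 * corrTwo α β))).const_mul q)
  refine h.congr_deriv ?_
  simp only [prof, profPoly, Nat.cast_ofNat, Nat.add_one_sub_one, Pi.pow_apply]
  have h2 : cos y ^ 2 = 1 - sin y ^ 2 := by linarith [sin_sq_add_cos_sq y]
  have h3 : cos y ^ 3 = cos y - cos y * sin y ^ 2 := by rw [pow_succ, h2]; ring
  ring_nf
  try rw [h3]
  rw [h2]
  ring

end Phase

section Rayleigh

variable {n : ℕ} {A : Matrix (Fin n) (Fin n) ℝ} {w : E n}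

lemma continuous_gradient {h : E n → ℝ} (hc : ContDiff ℝ 1 h) : Continuous (gradient h) :=
  (InnerProductSpace.toDual ℝ (E n)).symm.continuous.comp (hc.continuous_fderiv one_ne_zero)

lemma gradient_comp_phase_add {P P' : ℝ → ℝ} (hP : ∀ y, HasDerivAt P (P' y) y) {h : E n → ℝ}
    (hc : ContDiff ℝ 1 h) (x : E n) :
    gradient (fun x => P (phase w x) + h x) x = (2 * π * P' (phase w x)) • w + gradient h x := by
  refine ext_inner_left ℝ fun v => ?_
  have hd : HasFDerivAt (fun x => P (phase w x) + h x) _ x :=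
    (hasFDerivAt_comp_phase (w := w) hP x).add (hc.differentiable one_ne_zero x).hasFDerivAt
  rw [inner_gradient, hd.fderiv, inner_add_right, inner_gradient, inner_smul_right]
  simp only [add_apply, FunLike.coe_smul, Pi.smul_apply, smul_eq_mul, innerSL_apply_apply]
  rw [real_inner_comm]
  ring

lemma setIntegral_sq_gradient_split (hA : IsUnit A.det) (hw : w ∈ dualLattice (lattice A))
    (α β κ s p q : ℝ) {h : E n → ℝ} (hc : ContDiff ℝ 1 h) (hp : LatPeriodic A h) :
    (∫ x in fundDomain A, ‖gradient (fun x => prof α β s p q (phase w x) + h x) x‖ ^ 2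
        * Real.exp (α * s * sin (phase w x)))
      - 4 * π ^ 2 * ‖w‖ ^ 2 * (1 + κ * s ^ 2) *
        (∫ x in fundDomain A, (prof α β s p q (phase w x) + h x) ^ 2
          * Real.exp (β * s * sin (phase w x)))
    = 4 * π ^ 2 * ‖w‖ ^ 2 *
        (∫ x in fundDomain A, profRes α β κ s p q (sin (phase w x)) (cos (phase w x))
          * (prof α β s p q (phase w x) + 2 * h x))
      + ((∫ x in fundDomain A, ‖gradient h x‖ ^ 2 * Real.exp (α * s * sin (phase w x)))
        - 4 * π ^ 2 * ‖w‖ ^ 2 * (1 + κ * s ^ 2) *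
          (∫ x in fundDomain A, h x ^ 2 * Real.exp (β * s * sin (phase w x)))) := by
  set g : E n → ℝ := fun x => prof α β s p q (phase w x) + 2 * h x with hg
  have hv : ContDiff ℝ 1 fun x => prof α β s p q (phase w x) :=
    (contDiff_prof α β s p q).comp (contDiff_phase w)
  have hgc : ContDiff ℝ 1 g := hv.add (contDiff_const.mul hc)
  have hgp : LatPeriodic A g := fun x γ hγ => by
    have := latPeriodic_comp_phase hw (prof_periodic α β s p q) x γ hγ
    simp only [hg] at this ⊢
    rw [this, hp x γ hγ]
  have hgd : ∀ x, fderiv ℝ g x w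
      = 2 * π * ‖w‖ ^ 2 * prof' α β s p q (phase w x) + 2 * fderiv ℝ h x w := by
    intro x
    have : HasFDerivAt g _ x := (hasFDerivAt_comp_phase (w := w) (hasDerivAt_prof α β s p q) x).add
      ((hc.differentiable one_ne_zero x).hasFDerivAt.const_mul 2)
    rw [this.fderiv]
    simp only [add_apply, FunLike.coe_smul, Pi.smul_apply, smul_eq_mul, innerSL_apply_apply,
      real_inner_self_eq_norm_sq]
    ring
  set P : ℝ → ℝ := fun y => Real.exp (α * s * sin y) * prof' α β s p q y with hP
  set P' : ℝ → ℝ := fun y => Real.exp (α * s * sin y) *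
    (α * s * cos y * prof' α β s p q y + prof'' α β s p q y) with hP'
  have hPd : ∀ y, HasDerivAt P (P' y) y := fun y =>
    ((((hasDerivAt_sin y).const_mul (α * s)).exp).mul (hasDerivAt_prof' α β s p q y)).congr_deriv
      (by simp only [hP']; ring)
  have hI := setIntegral_phase_mul_fderiv hA hw hPd (by fun_prop)
    (periodic_trig (f := fun S C => Real.exp (α * s * S) * profPoly' α β s p q S C)) hgc hgp
  have hhc := hc.continuous
  have hgcc := hgc.continuous
  have hgf : Continuous fun x => fderiv ℝ g x w :=
    (hgc.continuous_fderiv one_ne_zero).clm_apply continuous_const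
  have hgr := continuous_gradient hc
  have hPc : Continuous P := by fun_prop
  have e1 : ∀ x, ‖gradient (fun x => prof α β s p q (phase w x) + h x) x‖ ^ 2
        * Real.exp (α * s * sin (phase w x))
      = 2 * π * (P (phase w x) * fderiv ℝ g x w)
        + ‖gradient h x‖ ^ 2 * Real.exp (α * s * sin (phase w x)) := by
    intro x
    rw [gradient_comp_phase_add (hasDerivAt_prof α β s p q) hc, norm_add_sq_real, hgd,
      inner_smul_left, inner_gradient, norm_smul, mul_pow, Real.norm_eq_abs, sq_abs, hP]
    simp only [conj_trivial]
    ring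
  have e2 : ∀ x, (prof α β s p q (phase w x) + h x) ^ 2 * Real.exp (β * s * sin (phase w x))
      = Real.exp (β * s * sin (phase w x)) * prof α β s p q (phase w x) * g x
        + h x ^ 2 * Real.exp (β * s * sin (phase w x)) := by
    intro x
    simp only [hg]
    ring
  have e3 : ∀ x, profRes α β κ s p q (sin (phase w x)) (cos (phase w x)) * g x
      = -(P' (phase w x) * g x) - (1 + κ * s ^ 2) *
        (Real.exp (β * s * sin (phase w x)) * prof α β s p q (phase w x) * g x) := by
    intro x
    simp only [profRes, hP', prof, prof', prof'']
    ring
  simp_rw [e1, e2]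
  change _ = 4 * π ^ 2 * ‖w‖ ^ 2 * (∫ x in fundDomain A,
    profRes α β κ s p q (sin (phase w x)) (cos (phase w x)) * g x) + _
  simp_rw [e3]
  have i1 : IntegrableOn (fun x => 2 * π * (P (phase w x) * fderiv ℝ g x w)) (fundDomain A) :=
    Continuous.integrableOn_fundDomain (by fun_prop)
  have i2 : IntegrableOn (fun x => ‖gradient h x‖ ^ 2 * Real.exp (α * s * sin (phase w x)))
    (fundDomain A) := Continuous.integrableOn_fundDomain (by fun_prop)
  have i3 : IntegrableOn (fun x => Real.exp (β * s * sin (phase w x))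
    * prof α β s p q (phase w x) * g x) (fundDomain A) :=
    Continuous.integrableOn_fundDomain (by fun_prop)
  have i4 : IntegrableOn (fun x => h x ^ 2 * Real.exp (β * s * sin (phase w x)))
    (fundDomain A) := Continuous.integrableOn_fundDomain (by fun_prop)
  have i5 : IntegrableOn (fun x => -(P' (phase w x) * g x)) (fundDomain A) :=
    Continuous.integrableOn_fundDomain (by fun_prop)
  rw [integral_add i1 i2, integral_add i3 i4, integral_sub i5 (i3.const_mul _),
    integral_const_mul, integral_const_mul, integral_neg, hI]
  ring

end Rayleigh

section Bounds

variable {n : ℕ} {A : Matrix (Fin n) (Fin n) ℝ} {w : E n}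

lemma exists_setIntegral_profRes_estimate (hA : IsUnit A.det) (hw : w ∈ dualLattice (lattice A))
    (hw0 : w ≠ 0) (α β κ : ℝ) : ∃ K > 0, ∃ s₀ > 0, ∀ s p q : ℝ, ∀ h : E n → ℝ, |s| ≤ s₀ →
      Continuous h → ∫ x in fundDomain A, h x * cos (phase w x) = 0 →
      ∫ x in fundDomain A, h x * sin (phase w x) = 0 →
      (∀ y, |prof α β s p q y| ≤ K * (|p| + |q|)) ∧
      |(∫ x in fundDomain A, profRes α β κ s p q (sin (phase w x)) (cos (phase w x))
          * (prof α β s p q (phase w x) + 2 * h x))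
        - s ^ 2 * (|A.det| / 2) * ((muCos α β - κ) * p ^ 2 + (muSin α β - κ) * q ^ 2)|
        ≤ K * |s| ^ 3 * ((p ^ 2 + q ^ 2) * |A.det| + ∫ x in fundDomain A, h x ^ 2) := by
  obtain ⟨K, hK, s₀, hs₀, H⟩ := exists_profile_estimate α β κ
  refine ⟨K, hK, s₀, hs₀, fun s p q h hs hc h1 h2 => ⟨fun y =>
    (H s _ _ p q 0 hs (sin_sq_add_cos_sq y)).1, ?_⟩⟩
  set a := muCos α β - κ
  set b := muSin α β - κ
  set F : E n → ℝ := fun x => profRes α β κ s p q (sin (phase w x)) (cos (phase w x))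
          * (prof α β s p q (phase w x) + 2 * h x) with hF
  set G : E n → ℝ := fun x => s ^ 2 * ((a * p * cos (phase w x) + b * q * sin (phase w x))
    * (p * cos (phase w x) + q * sin (phase w x) + 2 * h x)) with hG
  have iF : IntegrableOn F (fundDomain A) := Continuous.integrableOn_fundDomain (by
    simp only [hF, profRes, profPoly, profPoly', profPoly'']
    fun_prop)
  have iG : IntegrableOn G (fundDomain A) := Continuous.integrableOn_fundDomain (by fun_prop)
  have eG : ∫ x in fundDomain A, G x = s ^ 2 * (|A.det| / 2) * (a * p ^ 2 + b * q ^ 2) := by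
    have e : ∀ x, G x = s ^ 2 * (a * p ^ 2) * cos (phase w x) ^ 2
        + s ^ 2 * (b * q ^ 2) * sin (phase w x) ^ 2
        + s ^ 2 * ((a + b) * p * q) * (sin (phase w x) * cos (phase w x))
        + s ^ 2 * (2 * a * p) * (h x * cos (phase w x))
        + s ^ 2 * (2 * b * q) * (h x * sin (phase w x)) := by
      intro x
      simp only [hG]
      ring
    have i : ∀ (c : ℝ) (f : E n → ℝ), Continuous f →
        Integrable (fun x => c * f x) (volume.restrict (fundDomain A)) := fun c f hf =>
      Continuous.integrableOn_fundDomain (continuous_const.mul hf)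
    have j1 := i (s ^ 2 * (a * p ^ 2)) (fun x => cos (phase w x) ^ 2) (by fun_prop)
    have j2 := i (s ^ 2 * (b * q ^ 2)) (fun x => sin (phase w x) ^ 2) (by fun_prop)
    have j3 := i (s ^ 2 * ((a + b) * p * q)) (fun x => sin (phase w x) * cos (phase w x))
      (by fun_prop)
    have j4 := i (s ^ 2 * (2 * a * p)) (fun x => h x * cos (phase w x)) (by fun_prop)
    have j5 := i (s ^ 2 * (2 * b * q)) (fun x => h x * sin (phase w x)) (by fun_prop)
    have j12 := integral_add j1 j2
    have j123 := integral_add (j1.add j2) j3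
    have j1234 := integral_add ((j1.add j2).add j3) j4
    have j12345 := integral_add (((j1.add j2).add j3).add j4) j5
    simp only [Pi.add_apply] at j12 j123 j1234 j12345
    simp_rw [e]
    rw [j12345, j1234, j123, j12]
    simp only [integral_const_mul]
    rw [h1, h2, setIntegral_cos_sq_phase hA hw hw0, setIntegral_sin_sq_phase hA hw hw0,
      setIntegral_sin_mul_cos_phase hA hw hw0]
    ring
  rw [← eG, ← integral_sub iF iG]
  have i1 : IntegrableOn (fun x => h x ^ 2) (fundDomain A) :=
    Continuous.integrableOn_fundDomain (by fun_prop)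
  have i2 : IntegrableOn (fun _ : E n => p ^ 2 + q ^ 2) (fundDomain A) :=
    Continuous.integrableOn_fundDomain continuous_const
  rw [← setIntegral_fundDomain_const hA, ← integral_add i2 i1, ← integral_const_mul]
  refine abs_integral_le_integral_abs.trans
    (integral_mono (iF.sub iG).abs ((i2.add i1).const_mul _) fun x => ?_)
  exact (H s _ _ p q (h x) hs (sin_sq_add_cos_sq _)).2

lemma eventually_rayleigh_upper (hA : IsUnit A.det) (hw : w ∈ dualLattice (lattice A))
    (hw0 : w ≠ 0) (α β : ℝ) {ε : ℝ} (hε : 0 < ε) :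
    ∀ᶠ s in 𝓝 (0 : ℝ), ∃ f : E n → ℝ, ContDiff ℝ (⊤ : ℕ∞) f ∧ LatPeriodic A f ∧ f ≠ 0 ∧
      ∫ x in fundDomain A, f x * Real.exp (β * s * sin (phase w x)) = 0 ∧
      ∫ x in fundDomain A, ‖gradient f x‖ ^ 2 * Real.exp (α * s * sin (phase w x))
        ≤ 4 * π ^ 2 * ‖w‖ ^ 2 * (1 + (muCos α β + ε) * s ^ 2)
          * ∫ x in fundDomain A, f x ^ 2 * Real.exp (β * s * sin (phase w x)) := by
  obtain ⟨K, hK, s₀, hs₀, H⟩ := exists_setIntegral_profRes_estimate hA hw hw0 α β (muCos α β + ε)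
  have hD : 0 < |A.det| := abs_pos.2 hA.ne_zero
  have ev1 : ∀ᶠ s in 𝓝 (0 : ℝ), |s| < s₀ :=
    (continuous_abs.tendsto' 0 0 abs_zero).eventually_lt_const hs₀
  have ev2 : ∀ᶠ s in 𝓝 (0 : ℝ), K * (1 + K ^ 2) * |s| < ε / 2 := by
    refine Tendsto.eventually_lt_const (v := 0) (by positivity) ?_
    exact Continuous.tendsto' (by fun_prop) _ _ (by simp)
  have ev3 : ∀ᶠ s in 𝓝 (0 : ℝ), 0 < 1 + (muCos α β + ε) * s ^ 2 := by
    refine Tendsto.eventually_const_lt (v := 1) one_pos ?_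
    exact Continuous.tendsto' (by fun_prop) _ _ (by simp)
  filter_upwards [ev1, ev2, ev3] with s hs1 hs2 hs3
  set v : E n → ℝ := fun x => prof α β s 1 0 (phase w x) with hv
  have hvc : Continuous v := by fun_prop
  set b : E n → ℝ := fun x => Real.exp (β * s * sin (phase w x)) with hb
  have hbc : Continuous b := by fun_prop
  have hb0 : ∀ x, 0 < b x := fun x => Real.exp_pos _
  have ib : IntegrableOn b (fundDomain A) := Continuous.integrableOn_fundDomain hbc
  have ivb : IntegrableOn (fun x => v x * b x) (fundDomain A) :=
    Continuous.integrableOn_fundDomain (by fun_prop)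
  have hB : 0 < ∫ x in fundDomain A, b x := by
    refine setIntegral_pos_of_continuous hA hbc ?_ (fun x => (hb0 x).le)
      (fun h => (hb0 0).ne' (congrFun h 0))
    exact latPeriodic_comp_phase hw (periodic_trig (f := fun S _ => Real.exp (β * s * S)))
  set m := (∫ x in fundDomain A, v x * b x) / ∫ x in fundDomain A, b x with hm
  obtain ⟨hvK, -⟩ := H s 1 0 (fun _ => 0) hs1.le continuous_const (by simp) (by simp)
  simp only [abs_one, abs_zero, add_zero, mul_one] at hvK
  have hmK : |m| ≤ K := by
    rw [hm, abs_div, abs_of_pos hB, div_le_iff₀ hB, ← integral_const_mul]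
    refine abs_integral_le_integral_abs.trans (integral_mono ivb.abs (ib.const_mul _) fun x => ?_)
    simp only [abs_mul, abs_of_pos (hb0 x)]
    exact mul_le_mul_of_nonneg_right (hvK _) (hb0 x).le
  have hcos := setIntegral_cos_phase hA hw hw0
  have hsin := setIntegral_sin_phase hA hw hw0
  obtain ⟨-, hR⟩ := H s 1 0 (fun _ => -m) hs1.le continuous_const
    (by rw [integral_const_mul, hcos, mul_zero]) (by rw [integral_const_mul, hsin, mul_zero])
  have hsplit := setIntegral_sq_gradient_split hA hw α β (muCos α β + ε) s 1 0
    (h := fun _ => -m) contDiff_const (fun _ _ _ => rfl)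
  refine ⟨fun x => v x + -m, ?_, ?_, ?_, ?_, ?_⟩
  · exact ((contDiff_prof α β s 1 0).comp (contDiff_phase w)).add contDiff_const
  · intro x γ hγ
    have := latPeriodic_comp_phase hw (prof_periodic α β s 1 0) x γ hγ
    simp only [hv] at this ⊢
    rw [this]
  · intro h0
    have h1 := setIntegral_prof_mul_cos hA hw hw0 α β s 1 0
    have h2 : ∀ x, prof α β s 1 0 (phase w x) = m := fun x => by
      have := congrFun h0 x
      simp only [hv, Pi.zero_apply] at this
      linarith
    simp_rw [h2] at h1
    rw [integral_const_mul, hcos] at h1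
    linarith
  · simp_rw [add_mul]
    rw [integral_add ivb (ib.const_mul _), integral_const_mul, hm]
    field_simp
    ring
  · rw [setIntegral_fundDomain_const hA] at hR
    have hg0 : ∀ x : E n, gradient (fun _ : E n => -m) x = 0 := fun x => by simp [gradient]
    simp only [hg0, norm_zero, ne_eq, OfNat.ofNat_ne_zero, not_false_eq_true, zero_pow, zero_mul,
      integral_zero, integral_const_mul] at hsplit
    have hle := (abs_le.1 hR).2
    set I := ∫ x in fundDomain A,
      profRes α β (muCos α β + ε) s 1 0 (sin (phase w x)) (cos (phase w x))
          * (prof α β s 1 0 (phase w x) + 2 * -m)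
    have hI : I ≤ 0 := by
      have hm2 : m ^ 2 ≤ K ^ 2 := sq_le_sq' (abs_le.1 hmK).1 (abs_le.1 hmK).2
      have h3 : K * |s| ^ 3 * ((1 ^ 2 + 0 ^ 2) * |A.det| + (-m) ^ 2 * |A.det|)
          ≤ s ^ 2 * |A.det| * (ε / 2) := by
        calc _ = K * |s| ^ 3 * |A.det| * (1 + m ^ 2) := by ring
          _ ≤ K * |s| ^ 3 * |A.det| * (1 + K ^ 2) := by gcongr
          _ = |s| ^ 2 * |A.det| * (K * (1 + K ^ 2) * |s|) := by ring
          _ ≤ |s| ^ 2 * |A.det| * (ε / 2) := by gcongr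
          _ = _ := by rw [sq_abs]
      linarith
    have h4 : 4 * π ^ 2 * ‖w‖ ^ 2 * I ≤ 0 := mul_nonpos_of_nonneg_of_nonpos (by positivity) hI
    have h5 : 0 ≤ 4 * π ^ 2 * ‖w‖ ^ 2 * (1 + (muCos α β + ε) * s ^ 2)
        * ((-m) ^ 2 * ∫ x in fundDomain A, b x) := by positivity
    change _ ≤ _ * ∫ x in fundDomain A, (prof α β s 1 0 (phase w x) + -m) ^ 2
      * Real.exp (β * s * sin (phase w x))
    linarith

lemma eventually_rayleigh_lower (hA : IsUnit A.det) (hgap : GapCondition (lattice A) w) {α β : ℝ}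
    (hαβ : muCos α β ≤ muSin α β) {ε : ℝ} (hε : 0 < ε) :
    ∀ᶠ s in 𝓝 (0 : ℝ), ∀ f : E n → ℝ, ContDiff ℝ 1 f → LatPeriodic A f →
      ∫ x in fundDomain A, f x * Real.exp (β * s * sin (phase w x)) = 0 →
      4 * π ^ 2 * ‖w‖ ^ 2 * (1 + (muCos α β - ε) * s ^ 2)
          * ∫ x in fundDomain A, f x ^ 2 * Real.exp (β * s * sin (phase w x))
        ≤ ∫ x in fundDomain A, ‖gradient f x‖ ^ 2 * Real.exp (α * s * sin (phase w x)) := by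
  obtain ⟨hw, hw0, -⟩ := id hgap
  obtain ⟨R, hRw, hR⟩ := exists_spectral_gap hA hgap
  have hw0' := norm_pos_iff.2 hw0
  obtain ⟨K, hK, s₀, hs₀, H⟩ := exists_setIntegral_profRes_estimate hA hw hw0 α β (muCos α β - ε)
  have hD : 0 < |A.det| := abs_pos.2 hA.ne_zero
  set δ := 2 * π ^ 2 * (R ^ 2 - ‖w‖ ^ 2) with hδ
  have hδ0 : 0 < δ := by
    have : ‖w‖ ^ 2 < R ^ 2 := by gcongr
    have := pi_pos
    rw [hδ]
    have : 0 < R ^ 2 - ‖w‖ ^ 2 := by linarith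
    positivity
  have ev1 : ∀ᶠ s in 𝓝 (0 : ℝ), |s| < s₀ :=
    (continuous_abs.tendsto' 0 0 abs_zero).eventually_lt_const hs₀
  have ev2 : ∀ᶠ s in 𝓝 (0 : ℝ), K * |s| < ε / 2 := by
    refine Tendsto.eventually_lt_const (v := 0) (by positivity) ?_
    exact Continuous.tendsto' (by fun_prop) _ _ (by simp)
  have ev3 : ∀ᶠ s in 𝓝 (0 : ℝ), 0 < 1 + (muCos α β - ε) * s ^ 2 := by
    refine Tendsto.eventually_const_lt (v := 1) one_pos ?_
    exact Continuous.tendsto' (by fun_prop) _ _ (by simp)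
  have ev4 : ∀ᶠ s in 𝓝 (0 : ℝ), 4 * π ^ 2 * ‖w‖ ^ 2 * (K * |s| ^ 3) < δ := by
    refine Tendsto.eventually_lt_const (v := 0) hδ0 ?_
    exact Continuous.tendsto' (by fun_prop) _ _ (by simp)
  have ev5 : ∀ᶠ s in 𝓝 (0 : ℝ), δ < Real.exp (-|α * s|) * (4 * π ^ 2 * R ^ 2)
      - 4 * π ^ 2 * ‖w‖ ^ 2 * (1 + (muCos α β - ε) * s ^ 2) * Real.exp |β * s| := by
    refine Tendsto.eventually_const_lt (v := 2 * δ) (by linarith) ?_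
    refine Continuous.tendsto' (by fun_prop) _ _ ?_
    simp [hδ]
    ring
  filter_upwards [ev1, ev2, ev3, ev4, ev5] with s hs1 hs2 hs3 hs4 hs5 f hf hfp hfb
  have hfc := hf.continuous
  set Λ := 4 * π ^ 2 * ‖w‖ ^ 2 * (1 + (muCos α β - ε) * s ^ 2) with hΛ
  have hΛ0 : 0 ≤ Λ := by positivity
  set p := 2 / |A.det| * ∫ x in fundDomain A, f x * cos (phase w x) with hp
  set q := 2 / |A.det| * ∫ x in fundDomain A, f x * sin (phase w x) with hq
  set m := (∫ x in fundDomain A, f x) / |A.det| + q * s * β / 2 with hm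
  set v : E n → ℝ := fun x => prof α β s p q (phase w x) with hv
  have hvc : Continuous v := by fun_prop
  have hvs : ContDiff ℝ 1 v := (contDiff_prof α β s p q).comp (contDiff_phase w)
  have hvp : LatPeriodic A v := latPeriodic_comp_phase hw (prof_periodic α β s p q)
  set h : E n → ℝ := fun x => f x - v x - m with hh
  have hhs : ContDiff ℝ 1 h := (hf.sub hvs).sub contDiff_const
  have hhp : LatPeriodic A h := fun x γ hγ => by
    simp only [hh]
    rw [hfp x γ hγ, hvp x γ hγ]
  have hhc := hhs.continuous
  have hcos := setIntegral_cos_phase hA hw hw0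
  have hsin := setIntegral_sin_phase hA hw hw0
  have key : ∀ u : E n → ℝ, Continuous u → ∫ x in fundDomain A, h x * u x
      = (∫ x in fundDomain A, f x * u x) - (∫ x in fundDomain A, v x * u x)
        - m * ∫ x in fundDomain A, u x := by
    intro u hu
    have i1 : IntegrableOn (fun x => f x * u x) (fundDomain A) :=
      Continuous.integrableOn_fundDomain (by fun_prop)
    have i2 : IntegrableOn (fun x => v x * u x) (fundDomain A) :=
      Continuous.integrableOn_fundDomain (by fun_prop)
    have i3 : IntegrableOn (fun x => m * u x) (fundDomain A) :=
      Continuous.integrableOn_fundDomain (by fun_prop)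
    have e1 := integral_sub i1 i2
    have e2 := integral_sub (i1.sub i2) i3
    simp only [Pi.sub_apply] at e1 e2
    rw [← integral_const_mul, ← e1, ← e2]
    congr 1
    funext x
    simp only [hh]
    ring
  have h1 : ∫ x in fundDomain A, h x = 0 := by
    have := key (fun _ => 1) continuous_const
    simp only [mul_one] at this
    rw [this, setIntegral_prof hA hw hw0, setIntegral_fundDomain_const hA, hm]
    field_simp
    ring
  have h2 : ∫ x in fundDomain A, h x * cos (phase w x) = 0 := by
    rw [key _ (by fun_prop), setIntegral_prof_mul_cos hA hw hw0, hcos, hp]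
    field_simp
    ring
  have h3 : ∫ x in fundDomain A, h x * sin (phase w x) = 0 := by
    rw [key _ (by fun_prop), setIntegral_prof_mul_sin hA hw hw0, hsin, hq]
    field_simp
    ring
  have hpoin := poincare_of_gap hA (hw0'.le.trans hRw.le) hR hhs hhp h1 h2 h3
  obtain ⟨-, hres⟩ := H s p q h hs1.le hhc h2 h3
  have hsplit := setIntegral_sq_gradient_split hA hw α β (muCos α β - ε) s p q hhs hhp
  set a : E n → ℝ := fun x => Real.exp (α * s * sin (phase w x)) with ha
  set b : E n → ℝ := fun x => Real.exp (β * s * sin (phase w x)) with hb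
  have hac : Continuous a := by fun_prop
  have hbc : Continuous b := by fun_prop
  have hfg : ∀ x, v x + h x = f x + -m := fun x => by simp only [hh]; ring
  have hgrad : ∀ x, gradient (fun x => v x + h x) x = gradient f x := fun x => by
    simp only [hfg, gradient, fderiv_add_const]
  have hgrc := continuous_gradient hhs
  have hle1 : ∫ x in fundDomain A, f x ^ 2 * b x ≤ ∫ x in fundDomain A, (v x + h x) ^ 2 * b x := by
    have i1 : IntegrableOn (fun x => f x ^ 2 * b x) (fundDomain A) :=
      Continuous.integrableOn_fundDomain (by fun_prop)
    have i2 : IntegrableOn (fun x => 2 * m * (f x * b x)) (fundDomain A) :=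
      Continuous.integrableOn_fundDomain (by fun_prop)
    have i3 : IntegrableOn (fun x => m ^ 2 * b x) (fundDomain A) :=
      Continuous.integrableOn_fundDomain (by fun_prop)
    have e : ∀ x, (v x + h x) ^ 2 * b x = f x ^ 2 * b x - 2 * m * (f x * b x) + m ^ 2 * b x :=
      fun x => by rw [hfg]; ring
    have e1 := integral_sub i1 i2
    have e2 := integral_add (i1.sub i2) i3
    simp only [Pi.sub_apply] at e1 e2
    simp_rw [e]
    rw [e2, e1, integral_const_mul (2 * m), hfb]
    have : 0 ≤ ∫ x in fundDomain A, m ^ 2 * b x := integral_nonneg fun x => by positivity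
    linarith
  have hsinabs : ∀ (γ : ℝ) x, |γ * s * sin (phase w x)| ≤ |γ * s| := fun γ x => by
    rw [abs_mul]
    exact mul_le_of_le_one_right (abs_nonneg _) (abs_sin_le_one _)
  have ih2 : IntegrableOn (fun x => h x ^ 2) (fundDomain A) :=
    Continuous.integrableOn_fundDomain (by fun_prop)
  have hle2 : Real.exp (-|α * s|) * ∫ x in fundDomain A, ‖gradient h x‖ ^ 2
      ≤ ∫ x in fundDomain A, ‖gradient h x‖ ^ 2 * a x := by
    rw [← integral_const_mul]
    refine integral_mono (Continuous.integrableOn_fundDomain (by fun_prop))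
      (Continuous.integrableOn_fundDomain (by fun_prop)) fun x => ?_
    simp only
    rw [mul_comm]
    gcongr
    exact Real.exp_le_exp.2 (abs_le.1 (hsinabs α x)).1
  have hle3 : ∫ x in fundDomain A, h x ^ 2 * b x
      ≤ Real.exp |β * s| * ∫ x in fundDomain A, h x ^ 2 := by
    rw [← integral_const_mul]
    refine integral_mono (Continuous.integrableOn_fundDomain (by fun_prop))
      (Continuous.integrableOn_fundDomain (by fun_prop)) fun x => ?_
    simp only
    rw [mul_comm]
    gcongr
    exact Real.exp_le_exp.2 (abs_le.1 (hsinabs β x)).2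
  have hH0 : 0 ≤ ∫ x in fundDomain A, h x ^ 2 := integral_nonneg fun x => sq_nonneg _
  change (∫ x in fundDomain A, ‖gradient (fun x => v x + h x) x‖ ^ 2 * a x)
    - Λ * (∫ x in fundDomain A, (v x + h x) ^ 2 * b x) = _ at hsplit
  simp only [hgrad] at hsplit
  set Hh := ∫ x in fundDomain A, h x ^ 2
  set I := ∫ x in fundDomain A,
      profRes α β (muCos α β - ε) s p q (sin (phase w x)) (cos (phase w x))
          * (prof α β s p q (phase w x) + 2 * h x)
  have hI : -(K * |s| ^ 3 * Hh) ≤ I := by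
    have hge := (abs_le.1 hres).1
    have e1 : K * |s| ^ 3 * ((p ^ 2 + q ^ 2) * |A.det|)
        ≤ s ^ 2 * |A.det| * (p ^ 2 + q ^ 2) * (ε / 2) := by
      calc _ = |s| ^ 2 * |A.det| * (p ^ 2 + q ^ 2) * (K * |s|) := by ring
        _ ≤ |s| ^ 2 * |A.det| * (p ^ 2 + q ^ 2) * (ε / 2) := by gcongr
        _ = _ := by rw [sq_abs]
    have e2 : 0 ≤ s ^ 2 * (|A.det| / 2) * ((muSin α β - muCos α β) * q ^ 2) := by
      have := sub_nonneg.2 hαβ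
      positivity
    linarith
  have hI2 : -(δ * Hh) ≤ 4 * π ^ 2 * ‖w‖ ^ 2 * I := by
    calc -(δ * Hh) ≤ -(4 * π ^ 2 * ‖w‖ ^ 2 * (K * |s| ^ 3) * Hh) := by gcongr
      _ = 4 * π ^ 2 * ‖w‖ ^ 2 * -(K * |s| ^ 3 * Hh) := by ring
      _ ≤ _ := by gcongr
  have c1 : Λ * (∫ x in fundDomain A, f x ^ 2 * b x)
      ≤ Λ * ∫ x in fundDomain A, (v x + h x) ^ 2 * b x := by gcongr
  have c2 : Λ * (∫ x in fundDomain A, h x ^ 2 * b x) ≤ Λ * (Real.exp |β * s| * Hh) := by gcongr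
  have c3 : Real.exp (-|α * s|) * (4 * π ^ 2 * R ^ 2 * Hh)
      ≤ Real.exp (-|α * s|) * ∫ x in fundDomain A, ‖gradient h x‖ ^ 2 := by gcongr
  have c4 : δ * Hh ≤ (Real.exp (-|α * s|) * (4 * π ^ 2 * R ^ 2) - Λ * Real.exp |β * s|) * Hh := by
    gcongr
  linarith

end Bounds

section Expansion

lemma IsLittleO.mul_second_order {L W : ℝ → ℝ} {l₀ l₂ w₀ w₂ : ℝ}
    (hL : (fun t => L t - (l₀ + l₂ * t ^ 2)) =o[𝓝 0] fun t => t ^ 2)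
    (hW : (fun t => W t - (w₀ + w₂ * t ^ 2)) =o[𝓝 0] fun t => t ^ 2) :
    (fun t => L t * W t - (l₀ * w₀ + (l₀ * w₂ + l₂ * w₀) * t ^ 2)) =o[𝓝 0] fun t => t ^ 2 := by
  have hsq : Tendsto (fun t : ℝ => t ^ 2) (𝓝 0) (𝓝 0) :=
    Continuous.tendsto' (by fun_prop) _ _ (by simp)
  have h1 : (fun t => W t - w₀) =o[𝓝 0] fun _ => (1 : ℝ) := by
    have : (fun t => (W t - (w₀ + w₂ * t ^ 2)) + w₂ * t ^ 2) =o[𝓝 0] fun _ => (1 : ℝ) := by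
      refine (hW.trans_isBigO ?_).add ?_
      · exact ((isLittleO_one_iff ℝ).2 hsq).isBigO
      · exact ((isLittleO_one_iff ℝ).2 hsq).const_mul_left _
    exact this.congr_left fun t => by ring
  have h2 : (fun t => L t - l₀) =O[𝓝 0] fun t => t ^ 2 := by
    have : (fun t => (L t - (l₀ + l₂ * t ^ 2)) + l₂ * t ^ 2) =O[𝓝 0] fun t => t ^ 2 :=
      hL.isBigO.add ((isBigO_refl _ _).const_mul_left _)
    exact this.congr_left fun t => by ring
  have h3 : (fun t => (L t - l₀) * (W t - w₀)) =o[𝓝 0] fun t => t ^ 2 :=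
    (h2.mul_isLittleO h1).congr_right fun t => by ring
  exact (((hW.const_mul_left l₀).add (hL.const_mul_left w₀)).add h3).congr_left fun t => by ring

lemma IsLittleO.rpow_second_order {V : ℝ → ℝ} {D a : ℝ} (hD : 0 < D) (r : ℝ)
    (hV : (fun t => V t - (D + D * a * t ^ 2)) =o[𝓝 0] fun t => t ^ 2) :
    (fun t => V t ^ r - (D ^ r + D ^ r * r * a * t ^ 2)) =o[𝓝 0] fun t => t ^ 2 := by
  have hsq : Tendsto (fun t : ℝ => t ^ 2) (𝓝 0) (𝓝 0) :=
    Continuous.tendsto' (by fun_prop) _ _ (by simp)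
  have h2 : (fun t => V t - D) =O[𝓝 0] fun t => t ^ 2 := by
    have : (fun t => (V t - (D + D * a * t ^ 2)) + D * a * t ^ 2) =O[𝓝 0] fun t => t ^ 2 :=
      hV.isBigO.add ((isBigO_refl _ _).const_mul_left _)
    exact this.congr_left fun t => by ring
  have hlim : Tendsto V (𝓝 0) (𝓝 D) := by
    have := (h2.trans_tendsto hsq).add_const D
    simpa using this
  have hd := (Real.hasDerivAt_rpow_const (x := D) (p := r) (Or.inl hD.ne')).isLittleO.comp_tendsto
    hlim
  have hd' : (fun t => V t ^ r - D ^ r - (V t - D) * (r * D ^ (r - 1))) =o[𝓝 0] fun t => t ^ 2 :=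
    (hd.trans_isBigO h2).congr_left fun t => by simp
  refine (hd'.add (hV.const_mul_left (r * D ^ (r - 1)))).congr_left fun t => ?_
  have : D ^ r = D ^ (r - 1) * D := by
    rw [← Real.rpow_add_one hD.ne']
    congr 1
    ring
  rw [this]
  ring

variable {n : ℕ} {A : Matrix (Fin n) (Fin n) ℝ} {w : E n}

lemma setIntegral_exp_sin_phase_isLittleO (hA : IsUnit A.det) (hw : w ∈ dualLattice (lattice A))
    (hw0 : w ≠ 0) (β : ℝ) :
    (fun s => (∫ x in fundDomain A, Real.exp (β * s * sin (phase w x)))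
      - (|A.det| + |A.det| * (β ^ 2 / 4) * s ^ 2)) =o[𝓝 0] fun s => s ^ 2 := by
  have hO : (fun s => (∫ x in fundDomain A, Real.exp (β * s * sin (phase w x)))
      - (|A.det| + |A.det| * (β ^ 2 / 4) * s ^ 2)) =O[𝓝 0] fun s => s ^ 3 := by
    refine IsBigO.of_bound (|β| ^ 3 * |A.det|) ?_
    have ev : ∀ᶠ s in 𝓝 (0 : ℝ), |β * s| < 1 := by
      refine Tendsto.eventually_lt_const (v := 0) one_pos ?_
      exact Continuous.tendsto' (by fun_prop) _ _ (by simp)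
    filter_upwards [ev] with s hs
    set G : E n → ℝ := fun x => 1 + β * s * sin (phase w x)
      + β ^ 2 * s ^ 2 / 2 * sin (phase w x) ^ 2 with hG
    have j0 : IntegrableOn (fun _ : E n => (1 : ℝ)) (fundDomain A) :=
      Continuous.integrableOn_fundDomain continuous_const
    have j1 : IntegrableOn (fun x => β * s * sin (phase w x)) (fundDomain A) :=
      Continuous.integrableOn_fundDomain (by fun_prop)
    have j2 : IntegrableOn (fun x => β ^ 2 * s ^ 2 / 2 * sin (phase w x) ^ 2) (fundDomain A) :=
      Continuous.integrableOn_fundDomain (by fun_prop)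
    have eG : ∫ x in fundDomain A, G x = |A.det| + |A.det| * (β ^ 2 / 4) * s ^ 2 := by
      have e1 := integral_add j0 j1
      have e2 := integral_add (j0.add j1) j2
      simp only [Pi.add_apply] at e1 e2
      rw [hG, e2, e1, integral_const_mul, integral_const_mul, setIntegral_sin_phase hA hw hw0,
        setIntegral_sin_sq_phase hA hw hw0, setIntegral_fundDomain_const hA]
      ring
    have iF : IntegrableOn (fun x => Real.exp (β * s * sin (phase w x))) (fundDomain A) :=
      Continuous.integrableOn_fundDomain (by fun_prop)
    have iG : IntegrableOn G (fundDomain A) := Continuous.integrableOn_fundDomain (by fun_prop)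
    rw [← eG, ← integral_sub iF iG, Real.norm_eq_abs, norm_pow, Real.norm_eq_abs]
    calc _ ≤ ∫ _ in fundDomain A, |β| ^ 3 * |s| ^ 3 := by
          refine abs_integral_le_integral_abs.trans (integral_mono (iF.sub iG).abs
            (Continuous.integrableOn_fundDomain continuous_const) fun x => ?_)
          obtain ⟨r, hr, he⟩ := exists_exp_remainder β s (sin (phase w x)) hs.le
            (abs_sin_le_one _)
          have : Real.exp (β * s * sin (phase w x)) - G x = s ^ 3 * r := by
            rw [he, hG]
            ring
          simp only [this, abs_mul, abs_pow]
          rw [mul_comm]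
          gcongr
      _ = _ := by
          rw [setIntegral_fundDomain_const hA]
          ring
  exact hO.trans_isLittleO (isLittleO_pow_pow (by norm_num))

lemma isLittleO_comp_mul {F : ℝ → ℝ} {a b : ℝ} (c : ℝ)
    (h : (fun s => F s - (a + b * s ^ 2)) =o[𝓝 0] fun s => s ^ 2) :
    (fun t => F (c * t) - (a + b * c ^ 2 * t ^ 2)) =o[𝓝 0] fun t => t ^ 2 := by
  have hc : Tendsto (fun t : ℝ => c * t) (𝓝 0) (𝓝 0) :=
    Continuous.tendsto' (by fun_prop) _ _ (by simp)
  have h1 := h.comp_tendsto hc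
  have h2 : ((fun s : ℝ => s ^ 2) ∘ fun t => c * t) =O[𝓝 0] fun t => t ^ 2 :=
    ((isBigO_refl (fun t : ℝ => t ^ 2) _).const_mul_left (c ^ 2)).congr_left fun t => by
      simp only [Function.comp]
      ring
  refine (h1.trans_isBigO h2).congr_left fun t => ?_
  simp only [Function.comp]
  ring

lemma confLam1_isLittleO (hA : IsUnit A.det) (hgap : GapCondition (lattice A) w) (hn : 1 ≤ n) :
    (fun t => confLam1 A (uSin A w) t - (4 * π ^ 2 * ‖w‖ ^ 2 + 4 * π ^ 2 * ‖w‖ ^ 2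
      * muCos (((n : ℝ) - 2) / 2) (n / 2) * (√2 / √|A.det|) ^ 2 * t ^ 2))
      =o[𝓝 0] fun t => t ^ 2 := by
  obtain ⟨hw, hw0, -⟩ := id hgap
  have hw0' := norm_pos_iff.2 hw0
  set α : ℝ := ((n : ℝ) - 2) / 2 with hα
  set β : ℝ := (n : ℝ) / 2 with hβ
  have hαβ : muCos α β ≤ muSin α β := by
    have h1 : (1 : ℝ) ≤ n := by exact_mod_cast hn
    have : muSin α β - muCos α β = ((n : ℝ) - 1) / 4 := by
      simp only [muSin, muCos, corrTwo, corrOne, hα, hβ]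
      ring
    linarith
  set l := 4 * π ^ 2 * ‖w‖ ^ 2 with hl
  have hl0 : 0 < l := by positivity
  set c := √2 / √|A.det| with hc
  have ea : ∀ t x, ((n : ℝ) - 2) * t * uSin A w x / 2 = α * (c * t) * sin (phase w x) :=
    fun t x => by
      simp only [uSin, phase, hα, hc]
      ring
  have eb : ∀ t x, (n : ℝ) * t * uSin A w x / 2 = β * (c * t) * sin (phase w x) :=
    fun t x => by
      simp only [uSin, phase, hβ, hc]
      ring
  have htend : Tendsto (fun t : ℝ => c * t) (𝓝 0) (𝓝 0) :=
    Continuous.tendsto' (by fun_prop) _ _ (by simp)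
  rw [isLittleO_iff]
  intro η hη
  set ε := η / (l * (c ^ 2 + 1)) with hε
  have hε0 : 0 < ε := by positivity
  filter_upwards [htend.eventually (eventually_rayleigh_upper hA hw hw0 α β hε0),
    htend.eventually (eventually_rayleigh_lower hA hgap hαβ hε0)] with t hup hlow
  have hden : ∀ f : E n → ℝ, Continuous f → LatPeriodic A f → f ≠ 0 →
      0 < ∫ x in fundDomain A, f x ^ 2 * Real.exp (β * (c * t) * sin (phase w x)) := by
    intro f hf hfp hf0
    refine setIntegral_pos_of_continuous hA (by fun_prop) (fun x γ hγ => ?_)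
      (fun x => by positivity) fun h => hf0 (funext fun x => ?_)
    · have := latPeriodic_comp_phase hw
        (periodic_trig (f := fun S _ => Real.exp (β * (c * t) * S))) x γ hγ
      simp only at this ⊢
      rw [this, hfp x γ hγ]
    · have := congrFun h x
      simpa [Real.exp_ne_zero] using this
  have hS : confLam1 A (uSin A w) t ≤ l * (1 + (muCos α β + ε) * (c * t) ^ 2) := by
    obtain ⟨f, hf, hfp, hf0, hfb, hle⟩ := hup
    have hle' : confLam1 A (uSin A w) t
        ≤ (∫ x in fundDomain A, ‖gradient f x‖ ^ 2
            * Real.exp (((n : ℝ) - 2) * t * uSin A w x / 2))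
          / (∫ x in fundDomain A, (f x) ^ 2 * Real.exp ((n : ℝ) * t * uSin A w x / 2)) := by
      refine csInf_le ⟨0, ?_⟩ ⟨f, hf, hfp, hf0, by simp_rw [eb]; exact hfb, rfl⟩
      rintro _ ⟨g, -, -, -, -, rfl⟩
      exact div_nonneg (integral_nonneg fun x => by positivity)
        (integral_nonneg fun x => by positivity)
    refine hle'.trans ?_
    simp_rw [ea, eb]
    exact (div_le_iff₀ (hden f hf.continuous hfp hf0)).2 hle
  have hL : l * (1 + (muCos α β - ε) * (c * t) ^ 2) ≤ confLam1 A (uSin A w) t := by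
    obtain ⟨f, hf, hfp, hf0, hfb, -⟩ := hup
    refine le_csInf ⟨_, f, hf, hfp, hf0, by simp_rw [eb]; exact hfb, rfl⟩ ?_
    rintro _ ⟨g, hg, hgp, hg0, hgb, rfl⟩
    simp_rw [ea, eb] at hgb ⊢
    exact (le_div_iff₀ (hden g hg.continuous hgp hg0)).2
      (hlow g (hg.of_le (by exact_mod_cast le_top)) hgp hgb)
  have hεl : l * ε * (c * t) ^ 2 ≤ η * t ^ 2 := by
    have : l * ε * (c ^ 2 + 1) = η := by
      rw [hε]
      field_simp
    calc l * ε * (c * t) ^ 2 = l * ε * c ^ 2 * t ^ 2 := by ring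
      _ ≤ l * ε * (c ^ 2 + 1) * t ^ 2 := by
          gcongr
          linarith
      _ = η * t ^ 2 := by rw [this]
  rw [Real.norm_eq_abs, norm_pow, Real.norm_eq_abs, sq_abs, abs_le]
  constructor <;> linarith

lemma confVol_isLittleO (hA : IsUnit A.det) (hw : w ∈ dualLattice (lattice A)) (hw0 : w ≠ 0) :
    (fun t => confVol A (uSin A w) t - (|A.det|
      + |A.det| * ((n / 2 : ℝ) ^ 2 / 4 * (√2 / √|A.det|) ^ 2) * t ^ 2))
      =o[𝓝 0] fun t => t ^ 2 := by
  have h := isLittleO_comp_mul (√2 / √|A.det|)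
    (setIntegral_exp_sin_phase_isLittleO hA hw hw0 (n / 2 : ℝ))
  refine h.congr_left fun t => ?_
  have eb : ∀ x, (n : ℝ) * t * uSin A w x / 2
      = (n / 2 : ℝ) * (√2 / √|A.det| * t) * sin (phase w x) := fun x => by
    simp only [uSin, phase]
    ring
  simp only [confVol, eb]
  ring

end Expansion

/-- Second-order Taylor expansion of the normalized first eigenvalue along the conformal
deformation with `φ = u₁`:
`λ₁(t)·V_φ(t)^{2/n} = λ₁·D^{2/n} + ((n−1)²·λ₁·D^{(2−n)/n}/12)·t² + o(t²)`,
and the coefficient of `t²` is strictly positive. -/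
theorem statement9 (n : ℕ) (hn : 2 ≤ n) (A : Matrix (Fin n) (Fin n) ℝ) (hA : IsUnit A.det)
    (w : E n) (hgap : GapCondition (lattice A) w)
    (lam₁ : ℝ) (hlam₁ : lam₁ = 4 * π ^ 2 * ‖w‖ ^ 2)
    (φ : E n → ℝ) (hφ : φ = uSin A w) :
    ((fun t : ℝ => confLam1 A φ t * confVol A φ t ^ ((2 : ℝ) / n)
        - (lam₁ * |A.det| ^ ((2 : ℝ) / n)
          + ((n : ℝ) - 1) ^ 2 * lam₁ * |A.det| ^ ((2 - (n : ℝ)) / n) / 12 * t ^ 2))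
      =o[𝓝 (0 : ℝ)] fun t => t ^ 2) ∧
    0 < ((n : ℝ) - 1) ^ 2 * lam₁ * |A.det| ^ ((2 - (n : ℝ)) / n) / 12 := by
  subst hlam₁ hφ
  obtain ⟨hw, hw0, -⟩ := id hgap
  have hw0' := norm_pos_iff.2 hw0
  have hD : 0 < |A.det| := abs_pos.2 hA.ne_zero
  have hn2 : (2 : ℝ) ≤ n := by exact_mod_cast hn
  have hn0 : (0 : ℝ) < n := by linarith
  have hpow : |A.det| ^ ((2 - (n : ℝ)) / n) = |A.det| ^ ((2 : ℝ) / n) / |A.det| := by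
    rw [← Real.rpow_sub_one hD.ne']
    congr 1
    field_simp
  have hc : (√2 / √|A.det|) ^ 2 = 2 / |A.det| := by
    rw [div_pow, Real.sq_sqrt zero_le_two, Real.sq_sqrt hD.le]
  refine ⟨?_, ?_⟩
  · refine (IsLittleO.mul_second_order (confLam1_isLittleO hA hgap (by lia))
      (IsLittleO.rpow_second_order hD ((2 : ℝ) / n) (confVol_isLittleO hA hw hw0))).congr_left
        fun t => ?_
    rw [hpow, hc]
    simp only [muCos, corrTwo, corrOne]
    field_simp
    ring
  · have : 0 < (n : ℝ) - 1 := by linarith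
    positivity
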